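/- arXiv:1501.01999 — 3 statements merged into one kernel-verified Lean document; each statement's English description precedes it below -/
import Mathlib

section
/- Let F : T → S be an exact (triangulated) functor between triangulated categories, and assume T is compactly generated. Then: (a) F admits a right adjoint if and only if F preserves arbitrary coproducts; (b) F admits a left adjoint if and only if F preserves arbitrary products. -/
/-!
Formalization of statements from "Grothendieck-Neeman duality and the
Wirthmüller isomorphism" by Balmer, Dell'Ambrogio and Sanders.
-/

noncomputable section

open CategoryTheory CategoryTheory.Limits CategoryTheory.Pretriangulated
  CategoryTheory.MonoidalCategory CategoryTheory.MonoidalClosed Opposite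

universe v u u₁ u₂ u₃

namespace GN

section Compact

variable {C : Type u} [Category.{v} C]

/-- An object `t` is compact if `Hom(t, -)`, viewed as a functor to abelian groups,
preserves small coproducts. -/
def IsCompactObj [Preadditive C] (t : C) : Prop :=
  ∀ J : Type v, Nonempty (PreservesColimitsOfShape (Discrete J)
    (preadditiveCoyoneda.obj (op t)))

/-- A functor preserves arbitrary (small) coproducts. -/
def PreservesCoproducts {D : Type u₂} [Category.{v} D] (F : C ⥤ D) : Prop :=
  ∀ J : Type v, Nonempty (PreservesColimitsOfShape (Discrete J) F)

/-- A functor preserves arbitrary (small) products. -/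
def PreservesProducts {D : Type u₂} [Category.{v} D] (F : C ⥤ D) : Prop :=
  ∀ J : Type v, Nonempty (PreservesLimitsOfShape (Discrete J) F)

/-- A compactly generated category: it admits all small coproducts and
has a set of compact generators. -/
structure CompactlyGenerated (C : Type u) [Category.{v} C] [Preadditive C] : Prop where
  hasCoproducts : HasCoproducts.{v} C
  exists_generators : ∃ (ι : Type v) (G : ι → C), (∀ i, IsCompactObj (G i)) ∧
    ∀ t : C, (∀ (i : ι) (f : G i ⟶ t), f = 0) → IsZero t

end Compact

section Tensor

variable {C : Type u} [Category.{v} C] [MonoidalCategory C] [MonoidalClosed C]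

/-- The canonical map `hom(x,𝟙) ⊗ y ⟶ hom(x,y)`. -/
def rigidComparison (x y : C) : (ihom x).obj (𝟙_ C) ⊗ y ⟶ (ihom x).obj y :=
  MonoidalClosed.curry ((α_ x ((ihom x).obj (𝟙_ C)) y).inv ≫
    (((ihom.ev x).app (𝟙_ C)) ▷ y) ≫ (λ_ y).hom)

/-- An object `x` is rigid if `hom(x,𝟙) ⊗ y ⟶ hom(x,y)` is an isomorphism for all `y`. -/
def IsRigid (x : C) : Prop := ∀ y : C, IsIso (rigidComparison x y)

/-- An object `u` is `⊗`-invertible if `u ⊗ v ≅ 𝟙` for some `v`. -/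
def TensorInvertible (u : C) : Prop := ∃ v : C, Nonempty (u ⊗ v ≅ 𝟙_ C)

/-- The `κ`-twisted duality functor `D_κ = hom(-,κ)`. -/
@[reducible] def Dfun (κ : C) : Cᵒᵖ ⥤ C := MonoidalClosed.internalHom.flip.obj κ

/-- The canonical double-duality map `ϖ : x ⟶ D_κ D_κ (x)`, i.e. the unit/counit of the
self-adjunction of `D_κ = hom(-,κ)`. -/
def varpi [BraidedCategory C] (κ x : C) : x ⟶ (ihom ((ihom x).obj κ)).obj κ :=
  MonoidalClosed.curry ((β_ ((ihom x).obj κ) x).hom ≫ (ihom.ev x).app κ)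

/-- A rigidly-compactly generated tensor-triangulated category: it admits all small
coproducts, its compact objects coincide with its rigid objects, and it has a set of
compact generators. -/
structure RigidlyCompactlyGenerated (C : Type u) [Category.{v} C] [Preadditive C]
    [MonoidalCategory C] [MonoidalClosed C] : Prop where
  hasCoproducts : HasCoproducts.{v} C
  compact_iff_rigid : ∀ x : C, IsCompactObj x ↔ IsRigid x
  exists_generators : ∃ (ι : Type v) (G : ι → C), (∀ i, IsCompactObj (G i)) ∧
    ∀ t : C, (∀ (i : ι) (f : G i ⟶ t), f = 0) → IsZero t

end Tensor

section Triang

variable {C : Type u} [Category.{v} C] [HasZeroObject C] [Preadditive C] [HasShift C ℤ]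
  [∀ n : ℤ, (shiftFunctor C n).Additive] [Pretriangulated C]

/-- A thick triangulated subcategory, given as a predicate on objects:
it contains the zero objects, and is closed under shifts, cones and direct summands
(hence in particular under isomorphisms). -/
structure IsThickSubcategory (S : Set C) : Prop where
  zero : ∀ x : C, IsZero x → x ∈ S
  shift : ∀ x ∈ S, ∀ n : ℤ, x⟦n⟧ ∈ S
  ext₃ : ∀ T : Triangle C, (T ∈ distTriang C) → T.obj₁ ∈ S → T.obj₂ ∈ S → T.obj₃ ∈ S
  retract : ∀ x y : C, (∃ (s : x ⟶ y) (r : y ⟶ x), s ≫ r = 𝟙 x) → y ∈ S → x ∈ S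

/-- The thick subcategory generated by a set of objects. -/
def thickClosure (S : Set C) : Set C :=
  { x | ∀ T : Set C, IsThickSubcategory T → S ⊆ T → x ∈ T }

/-- A `C^c`-submodule of `C`: a thick triangulated subcategory which is closed under
tensoring with compact objects. -/
structure IsSubmodule [MonoidalCategory C] (S : Set C) extends IsThickSubcategory S : Prop where
  smul : ∀ c x : C, IsCompactObj c → x ∈ S → (c ⊗ x) ∈ S

end Triang

section Dual

variable {C : Type u} [Category.{v} C] [MonoidalCategory C] [BraidedCategory C]
  [MonoidalClosed C]

/-- `κ` is a (possibly external) dualizing object for `S ⊆ C`: the `κ`-twisted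
duality `D_κ = hom(-,κ)` preserves `S` and every object of `S` is `κ`-reflexive;
equivalently, `D_κ` restricts to an anti-equivalence `S^op ≃ S`. -/
structure IsExternalDualizing (S : Set C) (κ : C) : Prop where
  stable : ∀ x ∈ S, (ihom x).obj κ ∈ S
  reflexive : ∀ x ∈ S, IsIso (varpi κ x)

/-- `κ ∈ S` is a dualizing object for `S`. -/
structure IsDualizing (S : Set C) (κ : C) extends IsExternalDualizing S κ : Prop where
  mem : κ ∈ S

end Dual

section Pullback

variable {C : Type u₁} {D : Type u₂} [Category.{v} C] [Category.{v} D]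
  [Preadditive C] [MonoidalCategory C]

/-- The compact pull-back `f^#(D₀)` of a subcategory `D₀ ⊆ D` along `f_* : C ⥤ D`. -/
def compactPullback (fpush : C ⥤ D) (D₀ : Set D) : Set C :=
  { x | ∀ c : C, IsCompactObj c → fpush.obj (c ⊗ x) ∈ D₀ }

end Pullback

section Proj

variable {D : Type u₁} {C : Type u₂} [Category.{v} D] [Category.{v} C]
  [MonoidalCategory D] [MonoidalCategory C]

/-- The canonical projection formula map `π : x ⊗ f_*(y) ⟶ f_*(f^*(x) ⊗ y)`,
obtained by adjunction from `f^*(x ⊗ f_* y) ≅ f^* x ⊗ f^* f_* y → f^* x ⊗ y`. -/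
def projFormula (fstar : D ⥤ C) [fstar.Monoidal] (fpush : C ⥤ D) (adj : fstar ⊣ fpush)
    (x : D) (y : C) : x ⊗ fpush.obj y ⟶ fpush.obj (fstar.obj x ⊗ y) :=
  (adj.homEquiv _ _)
    (Functor.OplaxMonoidal.δ fstar x (fpush.obj y) ≫ (fstar.obj x ◁ adj.counit.app y))

/-- The canonical comparison map `f^(1)(x) ⊗ f^*(y) ⟶ f^(1)(x ⊗ y)`, obtained by
adjunction from the counit `f_* f^(1) → Id` via the projection formula. -/
def gnComparison [BraidedCategory D] [BraidedCategory C] (fstar : D ⥤ C) [fstar.Monoidal]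
    (fpush : C ⥤ D) (adj1 : fstar ⊣ fpush) (fone : D ⥤ C) (adj2 : fpush ⊣ fone)
    (hπ : ∀ (x : D) (y : C), IsIso (projFormula fstar fpush adj1 x y)) (x y : D) :
    fone.obj x ⊗ fstar.obj y ⟶ fone.obj (x ⊗ y) :=
  haveI := hπ y (fone.obj x)
  (adj2.homEquiv _ _)
    (fpush.map (β_ (fone.obj x) (fstar.obj y)).hom ≫
      inv (projFormula fstar fpush adj1 y (fone.obj x)) ≫
      (β_ y (fpush.obj (fone.obj x))).hom ≫ (adj2.counit.app x ▷ y))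

end Proj

section Telescope

variable {C : Type u} [Category.{v} C] [HasCoproducts.{v} C]

variable (X : ℕ → C) (φ : ∀ n, X n ⟶ X (n + 1))

/-- The composition `X 0 ⟶ X n` of the transition maps of a sequence. -/
def fromZero : ∀ n, X 0 ⟶ X n
  | 0 => 𝟙 _
  | n + 1 => fromZero n ≫ φ n

/-- The coproduct of a sequence of objects. -/
abbrev sigmaNat : C := ∐ fun n : ULift.{v} ℕ => X n.down

/-- The inclusions in the coproduct of a sequence. -/
abbrev sigmaNatι (n : ℕ) : X n ⟶ sigmaNat X :=
  Limits.Sigma.ι (fun n : ULift.{v} ℕ => X n.down) ⟨n⟩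

/-- The endomorphism of the coproduct of a sequence induced by the transition maps. -/
def sigmaNatShift : sigmaNat X ⟶ sigmaNat X :=
  Limits.Sigma.desc fun n => φ n.down ≫ sigmaNatι X (n.down + 1)

variable {X} in
lemma sigmaNat_hom_ext {Y : C} {f g : sigmaNat X ⟶ Y}
    (h : ∀ n, sigmaNatι X n ≫ f = sigmaNatι X n ≫ g) : f = g :=
  Limits.Sigma.hom_ext _ _ fun n => h n.down

lemma sigmaNatι_shift (n : ℕ) :
    sigmaNatι X n ≫ sigmaNatShift X φ = φ n ≫ sigmaNatι X (n + 1) := by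
  simp [sigmaNatShift]

lemma sigmaNatι_shift_assoc (n : ℕ) {Z : C} (g : sigmaNat X ⟶ Z) :
    sigmaNatι X n ≫ sigmaNatShift X φ ≫ g = φ n ≫ sigmaNatι X (n + 1) ≫ g := by
  rw [← Category.assoc, sigmaNatι_shift, Category.assoc]

/-- The morphism between coproducts of sequences induced by a family of morphisms. -/
abbrev sigmaNatMap {X Y : ℕ → C} (f : ∀ n, X n ⟶ Y n) : sigmaNat X ⟶ sigmaNat Y :=
  Limits.Sigma.map fun n : ULift.{v} ℕ => f n.down

lemma sigmaNatι_map {X Y : ℕ → C} (f : ∀ n, X n ⟶ Y n) (n : ℕ) :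
    sigmaNatι X n ≫ sigmaNatMap f = f n ≫ sigmaNatι Y n := by
  simp

lemma sigmaNatι_map_assoc {X Y : ℕ → C} (f : ∀ n, X n ⟶ Y n) (n : ℕ) {Z : C}
    (g : sigmaNat Y ⟶ Z) : sigmaNatι X n ≫ sigmaNatMap f ≫ g = f n ≫ sigmaNatι Y n ≫ g := by
  rw [← Category.assoc, sigmaNatι_map, Category.assoc]

variable [Preadditive C]

lemma exists_sigmaNat_retraction : ∃ r : sigmaNat X ⟶ sigmaNat fun n => X (n + 1),
    ∀ n, sigmaNatι X (n + 1) ≫ r = sigmaNatι (fun n => X (n + 1)) n :=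
  ⟨Limits.Sigma.desc fun n => match n with
    | ⟨0⟩ => 0
    | ⟨n + 1⟩ => sigmaNatι (fun n => X (n + 1)) n, fun n => by simp⟩

/-- The retraction of `1 - shift` on the countable copower of an object. -/
def copowerRetraction (A : C) : sigmaNat (fun _ => A) ⟶ sigmaNat fun _ => A :=
  Limits.Sigma.desc fun n => - ∑ j ∈ Finset.range n.down, sigmaNatι (fun _ => A) j

lemma sigmaNatι_copowerRetraction (A : C) (n : ℕ) :
    sigmaNatι (fun _ => A) n ≫ copowerRetraction A =
      - ∑ j ∈ Finset.range n, sigmaNatι (fun _ => A) j := by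
  simp [copowerRetraction]

lemma one_sub_shift_copowerRetraction (A : C) :
    (𝟙 _ - sigmaNatShift (fun _ => A) fun _ => 𝟙 A) ≫ copowerRetraction A = 𝟙 _ := by
  refine sigmaNat_hom_ext fun n => ?_
  rw [Preadditive.sub_comp, Preadditive.comp_sub, sigmaNatι_shift_assoc, Category.id_comp,
    Category.id_comp, Category.comp_id, sigmaNatι_copowerRetraction, sigmaNatι_copowerRetraction,
    Finset.sum_range_succ]
  abel

lemma copowerRetraction_naturality {A B : C} (f : A ⟶ B) :
    sigmaNatMap (fun _ => f) ≫ copowerRetraction B =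
      copowerRetraction A ≫ sigmaNatMap fun _ => f := by
  refine sigmaNat_hom_ext fun n => ?_
  rw [sigmaNatι_map_assoc, sigmaNatι_copowerRetraction, ← Category.assoc,
    sigmaNatι_copowerRetraction, Preadditive.neg_comp, Preadditive.sum_comp, Preadditive.comp_neg,
    Preadditive.comp_sum]
  simp only [sigmaNatι_map]

end Telescope

section Brown

variable {C : Type u} [Category.{v} C] [Preadditive C] [HasZeroObject C] [HasShift C ℤ]
  [∀ n : ℤ, (shiftFunctor C n).Additive] [Pretriangulated C] [HasCoproducts.{v} C]

/-- A family of objects `G` perfectly generates `C` if the functors `Hom(G i, -)` jointly detect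
zero objects, jointly preserve exactness of coproducts of sequences, and if a morphism on which
they are all injective has a cofibre map on which they are all surjective. -/
structure PerfectlyGenerates {ι : Type v} (G : ι → C) : Prop where
  isZero : ∀ t : C, (∀ (i : ι) (f : G i ⟶ t), f = 0) → IsZero t
  exact_sigma : ∀ {J : Type v} {K A B : J → C} (k : ∀ j, K j ⟶ A j) (f : ∀ j, A j ⟶ B j),
    (∀ j, k j ≫ f j = 0) →
    (∀ j i (g : G i ⟶ A j), g ≫ f j = 0 → ∃ h, h ≫ k j = g) →
    ∀ i (g : G i ⟶ ∐ A), g ≫ Limits.Sigma.map f = 0 → ∃ h, h ≫ Limits.Sigma.map k = g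
  surjective_of_injective : ∀ {X Y Z : C} (a : X ⟶ Y) (b : Y ⟶ Z) (c : Z ⟶ X⟦(1 : ℤ)⟧),
    Triangle.mk a b c ∈ distTriang C → (∀ i (g : G i ⟶ X), g ≫ a = 0 → g = 0) →
    ∀ i (g : G i ⟶ Z), ∃ h, h ≫ b = g

variable (C) in
/-- A contravariant cohomological functor to abelian groups which sends coproducts to products. -/
structure CohomologicalFunctor where
  /-- The action on objects. -/
  obj : C → Type v
  /-- The values are abelian groups. -/
  [addCommGroup : ∀ X, AddCommGroup (obj X)]
  /-- The contravariant action on morphisms. -/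
  map : ∀ {X Y : C}, (X ⟶ Y) → (obj Y →+ obj X)
  map_id : ∀ {X : C} (x : obj X), map (𝟙 X) x = x
  map_comp : ∀ {X Y Z : C} (f : X ⟶ Y) (g : Y ⟶ Z) (z : obj Z), map (f ≫ g) z = map f (map g z)
  map_add : ∀ {X Y : C} (f g : X ⟶ Y) (y : obj Y), map (f + g) y = map f y + map g y
  exact : ∀ {X Y Z : C} (a : X ⟶ Y) (b : Y ⟶ Z) (c : Z ⟶ X⟦(1 : ℤ)⟧),
    Triangle.mk a b c ∈ distTriang C → ∀ y : obj Y, map a y = 0 → ∃ z, map b z = y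
  sigma_ext : ∀ {J : Type v} (X : J → C) (x : obj (∐ X)),
    (∀ j, map (Limits.Sigma.ι X j) x = 0) → x = 0
  sigma_lift : ∀ {J : Type v} (X : J → C) (x : ∀ j, obj (X j)),
    ∃ y : obj (∐ X), ∀ j, map (Limits.Sigma.ι X j) y = x j

namespace CohomologicalFunctor

attribute [instance] CohomologicalFunctor.addCommGroup

variable (H : CohomologicalFunctor C)

lemma map_sub {X Y : C} (f g : X ⟶ Y) (y : H.obj Y) :
    H.map (f - g) y = H.map f y - H.map g y := by
  rw [eq_sub_iff_add_eq, ← H.map_add, sub_add_cancel]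

lemma map_zero {X Y : C} (y : H.obj Y) : H.map (0 : X ⟶ Y) y = 0 := by
  have := H.map_sub (0 : X ⟶ Y) 0 y
  rwa [sub_zero, sub_self] at this

end CohomologicalFunctor

namespace PerfectlyGenerates

variable {ι : Type v} {G : ι → C}

lemma surjective_sigma (hG : PerfectlyGenerates G) {J : Type v} {K A : J → C}
    (k : ∀ j, K j ⟶ A j) (hk : ∀ j i (g : G i ⟶ A j), ∃ h, h ≫ k j = g)
    (i : ι) (g : G i ⟶ ∐ A) : ∃ h, h ≫ Limits.Sigma.map k = g :=
  hG.exact_sigma k (fun j => (0 : A j ⟶ A j)) (by simp) (fun j i g _ => hk j i g) i g (by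
    have : Limits.Sigma.map (fun j => (0 : A j ⟶ A j)) = 0 := by
      ext; simp
    rw [this, comp_zero])

lemma isIso_of_bijective (hG : PerfectlyGenerates G) {X Y : C} (f : X ⟶ Y)
    (hinj : ∀ i (g : G i ⟶ X), g ≫ f = 0 → g = 0)
    (hsurj : ∀ i (g : G i ⟶ Y), ∃ h, h ≫ f = g) : IsIso f := by
  obtain ⟨Z, p, q, hD⟩ := distinguished_cocone_triangle f
  refine (Triangle.isZero₃_iff_isIso₁ _ hD).1 (hG.isZero Z fun i g => ?_)
  obtain ⟨h, rfl⟩ := hG.surjective_of_injective _ _ _ hD hinj i g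
  obtain ⟨h', rfl⟩ := hsurj i h
  have : f ≫ p = 0 := comp_distTriang_mor_zero₁₂ _ hD
  rw [Category.assoc, this, comp_zero]

end PerfectlyGenerates

section Tower

variable (X : ℕ → C) (φ : ∀ n, X n ⟶ X (n + 1))

/-- `H` restricted to the generators is presented at every stage of the sequence `X`: the
element `x 0` generates, and the kernel of `x n` is covered by `k n` and killed by `φ n`. -/
structure IsResolvingTower (H : CohomologicalFunctor C) {ι : Type v} (G : ι → C)
    (x : ∀ n, H.obj (X n)) {K : ℕ → C} (k : ∀ n, K n ⟶ X n) : Prop where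
  map_succ : ∀ n, H.map (φ n) (x (n + 1)) = x n
  comp_zero : ∀ n, k n ≫ φ n = 0
  cover : ∀ n i (g : G i ⟶ X n), H.map g (x n) = 0 → ∃ h, h ≫ k n = g
  surjective : ∀ i (y : H.obj (G i)), ∃ g : G i ⟶ X 0, H.map g (x 0) = y

namespace IsResolvingTower

variable {X φ} {H : CohomologicalFunctor C} {ι : Type v} {G : ι → C}
  {x : ∀ n, H.obj (X n)} {K : ℕ → C} {k : ∀ n, K n ⟶ X n}

lemma map_fromZero (h : IsResolvingTower X φ H G x k) (n : ℕ) :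
    H.map (fromZero X φ n) (x n) = x 0 := by
  induction n with
  | zero => exact H.map_id _
  | succ n ih => rw [fromZero, H.map_comp, h.map_succ, ih]

lemma comp_fromZero (h : IsResolvingTower X φ H G x k) (n : ℕ) :
    k 0 ≫ fromZero X φ (n + 1) = 0 := by
  induction n with
  | zero => simp [fromZero, h.comp_zero]
  | succ n ih => rw [fromZero, ← Category.assoc, ih, Limits.zero_comp]

lemma exists_decomposition (h : IsResolvingTower X φ H G x k) (hG : PerfectlyGenerates G)
    {i : ι} (g : G i ⟶ sigmaNat X) :
    ∃ (a : G i ⟶ sigmaNat fun _ => X 0) (b : G i ⟶ sigmaNat K),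
      g = a ≫ sigmaNatMap (fromZero X φ) + b ≫ sigmaNatMap k := by
  obtain ⟨c, rfl⟩ := hG.surjective_sigma
    (fun n : ULift.{v} ℕ => biprod.desc (fromZero X φ n.down) (k n.down)) (fun n j g => by
      obtain ⟨g₀, hg₀⟩ := h.surjective j (H.map g (x n.down))
      obtain ⟨l, hl⟩ := h.cover n.down j (g - g₀ ≫ fromZero X φ n.down) (by
        rw [H.map_sub, H.map_comp, h.map_fromZero, hg₀, sub_self])
      exact ⟨biprod.lift g₀ l, by rw [biprod.lift_desc, hl, add_sub_cancel]⟩) i g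
  refine ⟨c ≫ sigmaNatMap (fun n => biprod.fst), c ≫ sigmaNatMap (fun n => biprod.snd), ?_⟩
  rw [Category.assoc, Category.assoc, ← Preadditive.comp_add]
  congr 1
  refine sigmaNat_hom_ext (X := fun n => X 0 ⊞ K n) fun n => ?_
  rw [Preadditive.comp_add, sigmaNatι_map_assoc, sigmaNatι_map_assoc, sigmaNatι_map,
    sigmaNatι_map]
  simp [biprod.desc_eq]

lemma one_sub_shift_injective (h : IsResolvingTower X φ H G x k) (hG : PerfectlyGenerates G)
    {i : ι} (c : G i ⟶ sigmaNat X) (hc : c ≫ (𝟙 _ - sigmaNatShift X φ) = 0) : c = 0 := by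
  rw [Preadditive.comp_sub, Category.comp_id, sub_eq_zero] at hc
  obtain ⟨a, b, hab⟩ := h.exists_decomposition hG c
  have hks : sigmaNatMap k ≫ sigmaNatShift X φ = 0 := by
    refine sigmaNat_hom_ext fun n => ?_
    rw [sigmaNatι_map_assoc, sigmaNatι_shift, ← Category.assoc, h.comp_zero, Limits.zero_comp,
      Limits.comp_zero]
  have hσ : sigmaNatMap (fromZero X φ) ≫ sigmaNatShift X φ =
      sigmaNatShift (fun _ => X 0) (fun _ => 𝟙 _) ≫ sigmaNatMap (fromZero X φ) := by
    refine sigmaNat_hom_ext fun n => ?_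
    rw [sigmaNatι_map_assoc, sigmaNatι_shift, sigmaNatι_shift_assoc, sigmaNatι_map,
      Category.id_comp, fromZero, Category.assoc]
  have hc₁ : c = a ≫ sigmaNatMap (fromZero X φ) ≫ sigmaNatShift X φ := by
    rw [hc, hab, Preadditive.add_comp, Category.assoc, Category.assoc, hks, Limits.comp_zero,
      add_zero]
  obtain ⟨r, hr⟩ := exists_sigmaNat_retraction X
  have hψr : sigmaNatMap (fromZero X φ) ≫ sigmaNatShift X φ ≫ r =
      sigmaNatMap fun n => fromZero X φ (n + 1) := by
    refine sigmaNat_hom_ext fun n => ?_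
    rw [sigmaNatι_map_assoc, sigmaNatι_shift_assoc, hr, sigmaNatι_map, fromZero, Category.assoc]
  obtain ⟨l, hl⟩ := hG.exact_sigma (fun _ : ULift.{v} ℕ => k 0)
    (fun n => fromZero X φ (n.down + 1)) (fun n => h.comp_fromZero n.down)
    (fun n j g hg => h.cover 0 j g (by
      rw [← h.map_fromZero (n.down + 1), ← H.map_comp, hg, H.map_zero])) i
    (a ≫ (𝟙 _ - sigmaNatShift (fun _ => X 0) fun _ => 𝟙 _)) (by
      have : a ≫ (𝟙 _ - sigmaNatShift (fun _ => X 0) fun _ => 𝟙 _) ≫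
          sigmaNatMap (fromZero X φ) ≫ sigmaNatShift X φ ≫ r = 0 := by
        rw [Preadditive.sub_comp, Category.id_comp, ← reassoc_of% hσ, Preadditive.comp_sub,
          sub_eq_zero]
        have h₁ := hc =≫ r
        rw [hc₁] at h₁
        simpa only [Category.assoc] using h₁
      rw [hψr] at this
      simpa only [Category.assoc] using this)
  have ha : a = (l ≫ copowerRetraction _) ≫ sigmaNatMap fun _ => k 0 := by
    rw [Category.assoc, ← copowerRetraction_naturality, ← Category.assoc, hl, Category.assoc,
      one_sub_shift_copowerRetraction, Category.comp_id]
  have hz : (sigmaNatMap fun _ => k 0) ≫ sigmaNatMap (fromZero X φ) ≫ sigmaNatShift X φ = 0 := by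
    refine sigmaNat_hom_ext fun n => ?_
    have := h.comp_fromZero n
    rw [fromZero] at this
    rw [sigmaNatι_map_assoc, sigmaNatι_map_assoc, sigmaNatι_shift, reassoc_of% this,
      Limits.zero_comp, Limits.comp_zero]
  rw [hc₁, ha, Category.assoc, hz, Limits.comp_zero]

lemma exists_injective (h : IsResolvingTower X φ H G x k) (hG : PerfectlyGenerates G) :
    ∃ (Z : C) (z : H.obj Z) (f : X 0 ⟶ Z), H.map f z = x 0 ∧
      ∀ i (g : G i ⟶ Z), H.map g z = 0 → g = 0 := by
  obtain ⟨Z, p, q, hD⟩ := distinguished_cocone_triangle (𝟙 _ - sigmaNatShift X φ)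
  obtain ⟨y, hy⟩ := H.sigma_lift (fun n : ULift.{v} ℕ => X n.down) fun n => x n.down
  replace hy : ∀ n, H.map (sigmaNatι X n) y = x n := fun n => hy ⟨n⟩
  obtain ⟨z, hz⟩ := H.exact _ _ _ hD y (H.sigma_ext _ _ fun n => by
    rw [H.map_sub, H.map_id, _root_.map_sub, ← H.map_comp, sigmaNatι_shift X φ n.down,
      H.map_comp, hy, hy, h.map_succ, sub_self])
  have hp : ∀ n, φ n ≫ sigmaNatι X (n + 1) ≫ p = sigmaNatι X n ≫ p := fun n => by
    have hd : (𝟙 _ - sigmaNatShift X φ) ≫ p = 0 := comp_distTriang_mor_zero₁₂ _ hD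
    have := sigmaNatι X n ≫= hd
    rw [Preadditive.sub_comp, Category.id_comp, Preadditive.comp_sub, sigmaNatι_shift_assoc,
      Limits.comp_zero, sub_eq_zero] at this
    exact this.symm
  have hψ : ∀ n, fromZero X φ n ≫ sigmaNatι X n ≫ p = sigmaNatι X 0 ≫ p := fun n => by
    induction n with
    | zero => exact Category.id_comp _
    | succ n ih => rw [fromZero, Category.assoc, hp, ih]
  have hk : ∀ n, k n ≫ sigmaNatι X n ≫ p = 0 := fun n => by
    rw [← hp, ← Category.assoc, h.comp_zero, Limits.zero_comp]
  refine ⟨Z, z, sigmaNatι X 0 ≫ p, by rw [H.map_comp, hz, hy], fun i g hg => ?_⟩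
  obtain ⟨c, rfl⟩ := hG.surjective_of_injective _ _ _ hD
    (fun i c => h.one_sub_shift_injective hG c) i g
  obtain ⟨a, b, hab⟩ := h.exists_decomposition hG c
  have hκ : sigmaNatMap k ≫ p = 0 := sigmaNat_hom_ext fun n => by
    rw [sigmaNatι_map_assoc, hk, Limits.comp_zero]
  have hΨ : sigmaNatMap (fromZero X φ) ≫ p =
      Limits.Sigma.desc (fun _ => 𝟙 (X 0)) ≫ sigmaNatι X 0 ≫ p := sigmaNat_hom_ext fun n => by
    rw [sigmaNatι_map_assoc, hψ, Limits.Sigma.ι_desc_assoc, Category.id_comp]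
  have hcp : c ≫ p = (a ≫ Limits.Sigma.desc (fun _ => 𝟙 (X 0))) ≫ sigmaNatι X 0 ≫ p := by
    rw [hab, Preadditive.add_comp, Category.assoc, Category.assoc, hκ, hΨ, Limits.comp_zero,
      add_zero, Category.assoc]
  rw [hcp, H.map_comp, H.map_comp _ p, hz, hy] at hg
  obtain ⟨l, hl⟩ := h.cover 0 i _ hg
  rw [hcp, ← hl, Category.assoc, hk, Limits.comp_zero]

end IsResolvingTower

end Tower

namespace PerfectlyGenerates

variable {ι : Type v} {G : ι → C} (H : CohomologicalFunctor C)

variable (G) in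
lemma exists_kill_kernel (X : C) (x : H.obj X) :
    ∃ (X' : C) (x' : H.obj X') (φ : X ⟶ X') (K : C) (k : K ⟶ X), H.map φ x' = x ∧ k ≫ φ = 0 ∧
      ∀ i (g : G i ⟶ X), H.map g x = 0 → ∃ h, h ≫ k = g := by
  let J := Σ i, { g : G i ⟶ X // H.map g x = 0 }
  let k : (∐ fun j : J => G j.1) ⟶ X := Limits.Sigma.desc fun j => j.2.1
  obtain ⟨X', φ, q, hD⟩ := distinguished_cocone_triangle k
  obtain ⟨x', hx'⟩ := H.exact _ _ _ hD x (H.sigma_ext _ _ fun j => by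
    rw [← H.map_comp, Limits.Sigma.ι_desc]
    exact j.2.2)
  exact ⟨X', x', φ, _, k, hx', comp_distTriang_mor_zero₁₂ _ hD, fun i g hg =>
    ⟨Limits.Sigma.ι (fun j : J => G j.1) ⟨i, g, hg⟩, Limits.Sigma.ι_desc _ _⟩⟩

variable (G) in
lemma exists_surjective (Y : C) (y : H.obj Y) :
    ∃ (X : C) (x : H.obj X) (f : Y ⟶ X), H.map f x = y ∧
      ∀ i (y : H.obj (G i)), ∃ g : G i ⟶ X, H.map g x = y := by
  let J := Σ i, H.obj (G i)
  obtain ⟨w, hw⟩ := H.sigma_lift (fun j : J => G j.1) fun j => j.2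
  refine ⟨Y ⊞ (∐ fun j : J => G j.1), H.map biprod.fst y + H.map biprod.snd w, biprod.inl, ?_,
    fun i z => ⟨Limits.Sigma.ι (fun j : J => G j.1) ⟨i, z⟩ ≫ biprod.inr, ?_⟩⟩
  · rw [_root_.map_add, ← H.map_comp, ← H.map_comp, biprod.inl_fst, biprod.inl_snd, H.map_id,
      H.map_zero, add_zero]
  · rw [_root_.map_add, ← H.map_comp, ← H.map_comp, Category.assoc, Category.assoc,
      biprod.inr_fst, biprod.inr_snd, Limits.comp_zero, H.map_zero, zero_add, Category.comp_id]
    exact hw ⟨i, z⟩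

/-- Every element of a cohomological functor extends to one which represents it on the
generators. -/
lemma exists_bijective (hG : PerfectlyGenerates G) (Y : C) (y : H.obj Y) :
    ∃ (Z : C) (z : H.obj Z) (f : Y ⟶ Z), H.map f z = y ∧
      (∀ i (g : G i ⟶ Z), H.map g z = 0 → g = 0) ∧
      ∀ i (y : H.obj (G i)), ∃ g : G i ⟶ Z, H.map g z = y := by
  obtain ⟨X₀, x₀, f₀, hf₀, hsurj⟩ := exists_surjective G H Y y
  choose X' x' φ K k hφ hk hcover using exists_kill_kernel G H
  let tower : ℕ → Σ X, H.obj X := fun n => Nat.rec ⟨X₀, x₀⟩ (fun _ t => ⟨X' t.1 t.2, x' t.1 t.2⟩) n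
  have ht : IsResolvingTower (fun n => (tower n).1) (fun n => φ (tower n).1 (tower n).2) H G
      (fun n => (tower n).2) (fun n => k (tower n).1 (tower n).2) :=
    ⟨fun n => hφ _ _, fun n => hk _ _, fun n => hcover _ _, hsurj⟩
  obtain ⟨Z, z, f, hf, hinj⟩ := ht.exists_injective hG
  replace hf : H.map (X := X₀) f z = x₀ := hf
  refine ⟨Z, z, f₀ ≫ f, by rw [H.map_comp, hf, hf₀], hinj, fun i w => ?_⟩
  obtain ⟨g, hg⟩ := hsurj i w
  exact ⟨g ≫ f, by rw [H.map_comp, hf, hg]⟩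

/-- Brown representability for perfectly generated triangulated categories. -/
theorem exists_representing (hG : PerfectlyGenerates G) :
    ∃ (X : C) (x : H.obj X), ∀ Y, Function.Bijective fun f : Y ⟶ X => H.map f x := by
  obtain ⟨X, x, -, -, hinj, hsurj⟩ := hG.exists_bijective H _ (0 : H.obj (∐ G))
  have key : ∀ (Y : C) (y : H.obj Y) (f : X ⟶ Y), H.map f y = x →
      ∃ g : Y ⟶ X, H.map g x = y ∧ f ≫ g = 𝟙 X := fun Y y f hf => by
    obtain ⟨Z, z, g, hg, hinj', hsurj'⟩ := hG.exists_bijective H Y y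
    have hfg : H.map (f ≫ g) z = x := by rw [H.map_comp, hg, hf]
    have : IsIso (f ≫ g) := hG.isIso_of_bijective _
      (fun i a ha => hinj i a (by rw [← hfg, ← H.map_comp, ha, H.map_zero]))
      (fun i a => by
        obtain ⟨b, hb⟩ := hsurj i (H.map a z)
        refine ⟨b, sub_eq_zero.1 (hinj' i _ ?_)⟩
        rw [H.map_sub, H.map_comp, hfg, hb, sub_self])
    refine ⟨g ≫ inv (f ≫ g), ?_, by rw [← Category.assoc, IsIso.hom_inv_id]⟩
    rw [H.map_comp, ← hfg, ← H.map_comp (inv (f ≫ g)), IsIso.inv_hom_id, H.map_id, hg]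
  refine ⟨X, x, fun Y => ⟨fun a b hab => ?_, fun y => ?_⟩⟩
  · obtain ⟨Z, p, q, hD⟩ := distinguished_cocone_triangle (a - b)
    obtain ⟨z, hz⟩ := H.exact _ _ _ hD x (by
      dsimp at hab
      rw [H.map_sub, hab, sub_self])
    obtain ⟨g, -, hg⟩ := key Z z p hz
    have hp : (a - b) ≫ p = 0 := comp_distTriang_mor_zero₁₂ _ hD
    rw [← sub_eq_zero, ← Category.comp_id (a - b), ← hg, reassoc_of% hp, Limits.zero_comp]
  · obtain ⟨g, hg, -⟩ := key (X ⊞ Y) (H.map biprod.fst x + H.map biprod.snd y) biprod.inl (by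
      rw [_root_.map_add, ← H.map_comp, ← H.map_comp, biprod.inl_fst, biprod.inl_snd, H.map_id,
        H.map_zero, add_zero])
    refine ⟨biprod.inr ≫ g, ?_⟩
    dsimp
    rw [H.map_comp, hg, _root_.map_add, ← H.map_comp, ← H.map_comp, biprod.inr_fst,
      biprod.inr_snd, H.map_id, H.map_zero, zero_add]

end PerfectlyGenerates

end Brown

section FiniteFactorization

variable {C : Type u} [Category.{v} C] [Preadditive C] [HasCoproducts.{v} C]

/-- Every morphism from `c` to a coproduct is a finite sum of morphisms to the summands. -/
def FactorsFinitely (c : C) : Prop :=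
  ∀ (J : Type v) (X : J → C) (g : c ⟶ ∐ X), ∃ (s : Finset J) (y : ∀ j, c ⟶ X j),
    g = ∑ j ∈ s, y j ≫ Limits.Sigma.ι X j

/-- The canonical map from the direct sum of the `Hom(c, X j)` to `Hom(c, ∐ X)`. -/
def directSumHom (c : C) {J : Type v} [DecidableEq J] (X : J → C) :
    (DirectSum J fun j => c ⟶ X j) →+ (c ⟶ ∐ X) :=
  DirectSum.toAddMonoid fun j => Preadditive.rightComp c (Limits.Sigma.ι X j)

@[simp]
lemma directSumHom_of (c : C) {J : Type v} [DecidableEq J] (X : J → C) (j : J) (y : c ⟶ X j) :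
    directSumHom c X (DirectSum.of _ j y) = y ≫ Limits.Sigma.ι X j := by
  simp [directSumHom, Preadditive.rightComp]

/-- The projection of a coproduct to one of its summands. -/
def sigmaProj {J : Type v} [DecidableEq J] (X : J → C) (j : J) : ∐ X ⟶ X j :=
  Limits.Sigma.desc fun i => if h : i = j then eqToHom (by rw [h]) else 0

lemma ι_sigmaProj {J : Type v} [DecidableEq J] (X : J → C) (i j : J) :
    Limits.Sigma.ι X i ≫ sigmaProj X j = if h : i = j then eqToHom (by rw [h]) else 0 := by
  simp [sigmaProj]

lemma directSumHom_comp_sigmaProj (c : C) {J : Type v} [DecidableEq J] (X : J → C)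
    (y : DirectSum J fun j => c ⟶ X j) (j : J) : directSumHom c X y ≫ sigmaProj X j = y j := by
  induction y using DirectSum.induction_on with
  | zero => simp
  | of i y =>
    rw [directSumHom_of, Category.assoc, ι_sigmaProj]
    by_cases h : i = j
    · subst h
      simp
    · rw [dif_neg h, Limits.comp_zero, DirectSum.of_eq_of_ne _ _ _ (Ne.symm h)]
  | add y z hy hz => rw [map_add, Preadditive.add_comp, hy, hz, DirectSum.add_apply]

lemma directSumHom_injective (c : C) {J : Type v} [DecidableEq J] (X : J → C) :
    Function.Injective (directSumHom c X) := fun y z h => by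
  ext j
  rw [← directSumHom_comp_sigmaProj, h, directSumHom_comp_sigmaProj]

lemma FactorsFinitely.directSumHom_surjective {c : C} (hc : FactorsFinitely c) {J : Type v}
    [DecidableEq J] (X : J → C) : Function.Surjective (directSumHom c X) := fun g => by
  obtain ⟨s, y, rfl⟩ := hc J X g
  exact ⟨∑ j ∈ s, DirectSum.of _ j (y j), by simp⟩

lemma factorsFinitely_of_directSumHom_surjective {c : C}
    (h : ∀ {J : Type v} [DecidableEq J] (X : J → C), Function.Surjective (directSumHom c X)) :
    FactorsFinitely c := fun J X g => by
  classical
  obtain ⟨y, rfl⟩ := h X g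
  refine ⟨DFinsupp.support y, fun j => y j, ?_⟩
  conv_lhs => rw [← DirectSum.sum_support_of y]
  simp

lemma IsCompactObj.factorsFinitely {c : C} (hc : IsCompactObj c) : FactorsFinitely c :=
  factorsFinitely_of_directSumHom_surjective fun {J} _ X => by
    obtain ⟨_⟩ := hc J
    let R := (directSumHom c X).range
    have hcol := isColimitOfPreserves (preadditiveCoyoneda.obj (op c))
      (coproductIsCoproduct X)
    have : AddCommGrpCat.ofHom (QuotientAddGroup.mk' R) =
        (0 : AddCommGrpCat.of (c ⟶ ∐ X) ⟶ AddCommGrpCat.of ((c ⟶ ∐ X) ⧸ R)) := by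
      refine hcol.hom_ext fun ⟨j⟩ => ?_
      ext y
      exact (QuotientAddGroup.eq_zero_iff _).2 ⟨DirectSum.of _ j y, directSumHom_of c X j y⟩
    intro g
    have hg := ConcreteCategory.congr_hom this g
    exact (QuotientAddGroup.eq_zero_iff g).1 hg

lemma FactorsFinitely.of_equivalence {c : C} (hc : FactorsFinitely c) (E : C ⥤ C)
    [E.IsEquivalence] [E.Additive] {d : C} (e : c ≅ E.obj d) : FactorsFinitely d :=
  fun J X g => by
    obtain ⟨s, y, hy⟩ := hc J (fun j => E.obj (X j))
      (e.hom ≫ E.map g ≫ inv (sigmaComparison E X))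
    refine ⟨s, fun j => E.preimage (e.inv ≫ y j), E.map_injective ?_⟩
    rw [← Category.assoc, IsIso.comp_inv_eq, ← Iso.eq_inv_comp] at hy
    rw [hy, E.map_sum, Preadditive.sum_comp, Preadditive.comp_sum]
    simp

lemma FactorsFinitely.exact_sigma {c : C} (hc : FactorsFinitely c) {J : Type v} {K A B : J → C}
    (k : ∀ j, K j ⟶ A j) (f : ∀ j, A j ⟶ B j)
    (h : ∀ j (g : c ⟶ A j), g ≫ f j = 0 → ∃ h, h ≫ k j = g)
    (g : c ⟶ ∐ A) (hg : g ≫ Limits.Sigma.map f = 0) : ∃ h, h ≫ Limits.Sigma.map k = g := by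
  classical
  obtain ⟨y, rfl⟩ := hc.directSumHom_surjective A g
  have hy : ∀ j, ∃ h : c ⟶ K j, h ≫ k j = y j := fun j => h j _ (by
    have : Limits.Sigma.map f ≫ sigmaProj B j = sigmaProj A j ≫ f j := by
      refine Limits.Sigma.hom_ext _ _ fun i => ?_
      rw [Limits.Sigma.ι_map_assoc, ι_sigmaProj, ← Category.assoc, ι_sigmaProj]
      by_cases hij : i = j
      · subst hij
        simp
      · simp [hij]
    rw [← directSumHom_comp_sigmaProj, Category.assoc, ← this, reassoc_of% hg, Limits.zero_comp])
  choose h hh using hy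
  refine ⟨∑ j ∈ DFinsupp.support y, h j ≫ Limits.Sigma.ι K j, ?_⟩
  conv_rhs => rw [← DirectSum.sum_support_of y]
  simp [Preadditive.sum_comp, ← hh]

end FiniteFactorization

section CompactGeneration

variable {C : Type u} [Category.{v} C] [Preadditive C] [HasShift C ℤ]
  [∀ n : ℤ, (shiftFunctor C n).Additive] [HasCoproducts.{v} C]

/-- A family of objects, stable under shifts, out of which every map to a coproduct factors
finitely, and which detects zero objects. -/
structure IsCompactFamily {ι : Type v} (G : ι → C) : Prop where
  factorsFinitely : ∀ i, FactorsFinitely (G i)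
  isZero : ∀ t : C, (∀ (i : ι) (f : G i ⟶ t), f = 0) → IsZero t
  shift : ∀ i, ∃ j, Nonempty (G j ≅ (G i)⟦(1 : ℤ)⟧)
  unshift : ∀ i, ∃ j, Nonempty ((G j)⟦(1 : ℤ)⟧ ≅ G i)

lemma CompactlyGenerated.exists_isCompactFamily (hC : CompactlyGenerated C) :
    ∃ (ι : Type v) (G : ι → C), IsCompactFamily G := by
  obtain ⟨ι, G, hG, hz⟩ := hC.exists_generators
  refine ⟨ι × ULift.{v} ℤ, fun p => (G p.1)⟦p.2.down⟧, fun p => ?_, fun t ht => hz t ?_,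
    fun p => ⟨⟨p.1, ⟨p.2.down + 1⟩⟩, ⟨(shiftFunctorAdd C p.2.down 1).app _⟩⟩,
    fun p => ⟨⟨p.1, ⟨p.2.down - 1⟩⟩,
      ⟨((shiftFunctorAdd' C (p.2.down - 1) 1 p.2.down (by lia)).app _).symm⟩⟩⟩
  · exact (hG p.1).factorsFinitely.of_equivalence (shiftFunctor C (-p.2.down))
      ((shiftFunctorCompIsoId C p.2.down (-p.2.down) (by lia)).app _).symm
  · intro i f
    rw [← cancel_epi ((shiftFunctorZero C ℤ).hom.app (G i)), Limits.comp_zero]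
    exact ht ⟨i, ⟨0⟩⟩ _

variable [HasZeroObject C] [Pretriangulated C]

namespace IsCompactFamily

variable {ι : Type v} {G : ι → C}

lemma perfectlyGenerates (hG : IsCompactFamily G) : PerfectlyGenerates G where
  isZero := hG.isZero
  exact_sigma k f _ h i g hg := (hG.factorsFinitely i).exact_sigma k f (fun j => h j i) g hg
  surjective_of_injective {X Y Z} a b c hD h i g := by
    obtain ⟨j, ⟨e⟩⟩ := hG.unshift i
    have hac : c ≫ a⟦1⟧' = 0 := comp_distTriang_mor_zero₃₁ _ hD
    have hz : (shiftFunctor C (1 : ℤ)).preimage (e.hom ≫ g ≫ c) = 0 :=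
      h j _ ((shiftFunctor C (1 : ℤ)).map_injective (by simp [hac]))
    have hgc : g ≫ c = 0 := by
      rw [← cancel_epi e.hom, ← (shiftFunctor C (1 : ℤ)).map_preimage (e.hom ≫ g ≫ c), hz]
      simp
    obtain ⟨l, hl⟩ := Triangle.coyoneda_exact₃ _ hD g hgc
    exact ⟨l, hl.symm⟩

lemma injective_of_surjective (hG : IsCompactFamily G) {X Y Z : C} (a : X ⟶ Y) (b : Y ⟶ Z)
    (c : Z ⟶ X⟦(1 : ℤ)⟧) (hD : Triangle.mk a b c ∈ distTriang C)
    (h : ∀ i (g : G i ⟶ Z), ∃ h, h ≫ b = g) (i : ι) (g : G i ⟶ X) (hg : g ≫ a = 0) : g = 0 := by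
  obtain ⟨j, ⟨e⟩⟩ := hG.shift i
  have hbc : b ≫ c = 0 := comp_distTriang_mor_zero₂₃ _ hD
  obtain ⟨l, hl⟩ : ∃ l : (G i)⟦(1 : ℤ)⟧ ⟶ Z, g⟦1⟧' = l ≫ c :=
    Triangle.coyoneda_exact₁ _ hD (g⟦1⟧') (by
      change g⟦1⟧' ≫ a⟦1⟧' = 0
      rw [← Functor.map_comp, hg, Functor.map_zero])
  obtain ⟨m, hm⟩ := h j (e.hom ≫ l)
  refine (shiftFunctor C (1 : ℤ)).map_injective ?_
  rw [hl, Functor.map_zero, ← cancel_epi e.hom, ← Category.assoc, ← hm, Category.assoc, hbc,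
    Limits.comp_zero, Limits.comp_zero]

end IsCompactFamily

/-- The product of the representable functors attached to a family of objects. -/
def piHom {J : Type v} (X : J → C) : CohomologicalFunctor C where
  obj Y := ∀ j, Y ⟶ X j
  map f := AddMonoidHom.mk' (fun y j => f ≫ y j) (fun y z => by
    ext j
    exact Preadditive.comp_add _ _ _ _ _ _)
  map_id y := funext fun j => Category.id_comp (y j)
  map_comp f g z := funext fun j => Category.assoc f g (z j)
  map_add f g y := funext fun j => Preadditive.add_comp _ _ _ f g (y j)
  exact a b c hD y hy := by
    have := fun j => Triangle.yoneda_exact₂ _ hD (y j) (congr_fun hy j)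
    choose z hz using this
    exact ⟨z, funext fun j => (hz j).symm⟩
  sigma_ext A x hx := funext fun j => Limits.Sigma.hom_ext _ _ fun i => by
    change Limits.Sigma.ι A i ≫ x j = Limits.Sigma.ι A i ≫ (0 : ∐ A ⟶ X j)
    rw [Limits.comp_zero]
    exact congr_fun (hx i) j
  sigma_lift A x := ⟨fun j => Limits.Sigma.desc fun i => x i j, fun i => funext fun j =>
    Limits.Sigma.ι_desc _ _⟩

lemma PerfectlyGenerates.hasProducts {ι : Type v} {G : ι → C} (hG : PerfectlyGenerates G) :
    HasProducts.{v} C := by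
  have h : ∀ (J : Type v) (X : J → C), ∃ (P : C) (p : ∀ j, P ⟶ X j),
      ∀ Y, Function.Bijective fun (f : Y ⟶ P) j => f ≫ p j :=
    fun J X => hG.exists_representing (piHom X)
  choose P p hp using h
  choose l hl using fun (J : Type v) (X : J → C) (Y : C) => (hp J X Y).2
  exact hasProducts_of_limit_fans (fun {J} X => Fan.mk (P J X) (p J X)) fun {J} X =>
    Fan.IsLimit.mk _ (fun s => l J X _ s.proj) (fun s j => congr_fun (hl J X _ s.proj) j)
      (fun s m hm => (hp J X _).1 ((funext hm).trans (hl J X _ s.proj).symm))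

end CompactGeneration

section Character

variable {A B D : Type v} [AddCommGroup A] [AddCommGroup B] [AddCommGroup D]

lemma exists_character_extension (f : A →+ B) (g : B →+ D) (h : ∀ b, g b = 0 → ∃ a, f a = b)
    (χ : B →+ AddCircle (1 : ℚ)) (hχ : χ.comp f = 0) :
    ∃ ψ : D →+ AddCircle (1 : ℚ), ψ.comp g = χ := by
  have hker : ∀ b ∈ g.ker, χ b = 0 := fun b hb => by
    obtain ⟨a, rfl⟩ := h b hb
    exact DFunLike.congr_fun hχ a
  obtain ⟨ψ, hψ⟩ := CharacterModule.dual_surjective_of_injective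
    (QuotientAddGroup.kerLift g).toIntLinearMap (QuotientAddGroup.kerLift_injective g)
    (QuotientAddGroup.lift g.ker χ hker)
  exact ⟨ψ, AddMonoidHom.ext fun b => DFunLike.congr_fun hψ (QuotientAddGroup.mk b)⟩

lemma exists_eq_of_character_extension (f : A →+ B) (g : B →+ D)
    (h : ∀ χ : B →+ AddCircle (1 : ℚ), χ.comp f = 0 → ∃ ψ : D →+ AddCircle (1 : ℚ), ψ.comp g = χ)
    (b : B) (hb : g b = 0) : ∃ a, f a = b := by
  refine (QuotientAddGroup.eq_zero_iff (N := f.range) b).1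
    (CharacterModule.eq_zero_of_character_apply fun c => ?_)
  let χ : B →+ AddCircle (1 : ℚ) := AddMonoidHom.comp c (QuotientAddGroup.mk' f.range)
  obtain ⟨ψ, hψ⟩ := h χ (AddMonoidHom.ext fun a => by
    have : (QuotientAddGroup.mk' f.range) (f a) = 0 := (QuotientAddGroup.eq_zero_iff _).2 ⟨a, rfl⟩
    change c ((QuotientAddGroup.mk' f.range) (f a)) = 0
    rw [this]
    exact AddMonoidHom.map_zero c)
  change χ b = 0
  rw [← hψ, AddMonoidHom.comp_apply, hb, map_zero]

end Character

section BrownComenetzDual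

variable {C : Type u} [Category.{v} C] [Preadditive C]

/-- `χ` exhibits `I` as the Brown–Comenetz dual of `c`. -/
def IsBrownComenetzDual (c I : C) (χ : (c ⟶ I) →+ AddCircle (1 : ℚ)) : Prop :=
  ∀ Y, Function.Bijective fun f : Y ⟶ I => χ.comp (Preadditive.rightComp c f)

lemma IsBrownComenetzDual.exact_iff {c I : C} {χ : (c ⟶ I) →+ AddCircle (1 : ℚ)}
    (hI : IsBrownComenetzDual c I χ) {X Y Z : C} (a : X ⟶ Y) (b : Y ⟶ Z) :
    (∀ g : Y ⟶ I, a ≫ g = 0 → ∃ h, b ≫ h = g) ↔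
      ∀ x : c ⟶ Y, x ≫ b = 0 → ∃ y, y ≫ a = x := by
  have hcomp : ∀ {X Y : C} (f : X ⟶ Y) (g : Y ⟶ I),
      (χ.comp (Preadditive.rightComp c g)).comp (Preadditive.rightComp c f) =
        χ.comp (Preadditive.rightComp c (f ≫ g)) := fun f g =>
    AddMonoidHom.ext fun x => congr_arg χ (Category.assoc x f g)
  have hzero : ∀ {X : C} (g : X ⟶ I), χ.comp (Preadditive.rightComp c g) = 0 ↔ g = 0 :=
    fun {X} g => by
      have h₀ : χ.comp (Preadditive.rightComp c (0 : X ⟶ I)) = 0 :=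
        AddMonoidHom.ext fun x => (congr_arg χ Limits.comp_zero).trans χ.map_zero
      exact ⟨fun h => (hI X).1 (h.trans h₀.symm), fun h => h ▸ h₀⟩
  constructor
  · intro h
    refine exists_eq_of_character_extension (Preadditive.rightComp c a)
      (Preadditive.rightComp c b) fun ξ hξ => ?_
    obtain ⟨g, rfl⟩ := (hI Y).2 ξ
    dsimp only at hξ
    rw [hcomp, hzero] at hξ
    obtain ⟨l, rfl⟩ := h g hξ
    exact ⟨_, hcomp b l⟩
  · intro h g hg
    obtain ⟨ψ, hψ⟩ := exists_character_extension (Preadditive.rightComp c a)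
      (Preadditive.rightComp c b) h (χ.comp (Preadditive.rightComp c g))
      (by rw [hcomp, hzero, hg])
    obtain ⟨l, rfl⟩ := (hI Z).2 ψ
    exact ⟨l, (hI Y).1 ((hcomp b l).symm.trans hψ)⟩

end BrownComenetzDual

section BrownComenetz

variable {C : Type u} [Category.{v} C] [Preadditive C] [HasZeroObject C] [HasShift C ℤ]
  [∀ n : ℤ, (shiftFunctor C n).Additive] [Pretriangulated C] [HasCoproducts.{v} C]

/-- The functor sending `Y` to the group of characters of `Hom(c, Y)`. -/
def characterHom {c : C} (hc : FactorsFinitely c) : CohomologicalFunctor C where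
  obj Y := (c ⟶ Y) →+ AddCircle (1 : ℚ)
  map f := AddMonoidHom.mk' (fun χ => χ.comp (Preadditive.rightComp c f)) (fun _ _ => rfl)
  map_id χ := AddMonoidHom.ext fun x => congr_arg χ (Category.comp_id x)
  map_comp f g χ := AddMonoidHom.ext fun x => congr_arg χ (Category.assoc x f g).symm
  map_add f g χ := AddMonoidHom.ext fun x =>
    (congr_arg χ (Preadditive.comp_add _ _ _ x f g)).trans (χ.map_add _ _)
  exact a b _ hD χ hχ := exists_character_extension (Preadditive.rightComp c a)
    (Preadditive.rightComp c b) (fun y hy => by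
      obtain ⟨x, hx⟩ := Triangle.coyoneda_exact₂ _ hD y hy
      exact ⟨x, hx.symm⟩) χ hχ
  sigma_ext X χ hχ := AddMonoidHom.ext fun g => by
    obtain ⟨s, y, rfl⟩ := hc _ X g
    rw [map_sum]
    exact Finset.sum_eq_zero fun j _ => DFunLike.congr_fun (hχ j) (y j)
  sigma_lift {J} X χ := by
    classical
    let e := AddEquiv.ofBijective (directSumHom c X)
      ⟨directSumHom_injective c X, hc.directSumHom_surjective X⟩
    refine ⟨(DirectSum.toAddMonoid χ).comp e.symm.toAddMonoidHom, fun j =>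
      AddMonoidHom.ext fun y => ?_⟩
    have : e.symm (y ≫ Limits.Sigma.ι X j) = DirectSum.of _ j y := by
      rw [AddEquiv.symm_apply_eq]
      exact (directSumHom_of c X j y).symm
    change DirectSum.toAddMonoid χ (e.symm (y ≫ Limits.Sigma.ι X j)) = χ j y
    rw [this, DirectSum.toAddMonoid_of]

open Pretriangulated.Opposite in
lemma IsCompactFamily.perfectlyGenerates_op {ι : Type v} {G : ι → C} (hG : IsCompactFamily G)
    [HasCoproducts.{v} Cᵒᵖ] {I : ι → C} {χ : ∀ i, (G i ⟶ I i) →+ AddCircle (1 : ℚ)}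
    (hI : ∀ i, IsBrownComenetzDual (G i) (I i) (χ i)) :
    PerfectlyGenerates fun i => op (I i) where
  isZero t ht := by
    have : IsZero t.unop := hG.isZero _ fun i x => by
      obtain ⟨y, rfl⟩ := ((hI i).exact_iff (0 : t.unop ⟶ t.unop) (0 : t.unop ⟶ t.unop)).1
        (fun g _ => ⟨0, by rw [Limits.comp_zero]; exact Quiver.Hom.op_inj (ht i g.op).symm⟩) x
        Limits.comp_zero
      rw [Limits.comp_zero]
    exact this.op
  exact_sigma {J K A B} k f _ h i := by
    have hj : ∀ j (x : G i ⟶ (A j).unop), x ≫ (k j).unop = 0 → ∃ y, y ≫ (f j).unop = x :=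
      fun j => ((hI i).exact_iff (f j).unop (k j).unop).1 fun g hg => by
        obtain ⟨l, hl⟩ := h j i g.op (Quiver.Hom.unop_inj hg)
        exact ⟨l.unop, Quiver.Hom.op_inj hl⟩
    have hprod : ∀ x : G i ⟶ (∐ A).unop, x ≫ (Limits.Sigma.map k).unop = 0 →
        ∃ y, y ≫ (Limits.Sigma.map f).unop = x := fun x hx => by
      have hxj : ∀ j, (x ≫ (Limits.Sigma.ι A j).unop) ≫ (k j).unop = 0 := fun j => by
        rw [Category.assoc, ← unop_comp, ← Limits.Sigma.ι_map, unop_comp, reassoc_of% hx,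
          Limits.zero_comp]
      choose y hy using fun j => hj j _ (hxj j)
      refine ⟨(Limits.Sigma.desc fun j => (y j).op).unop, Quiver.Hom.op_inj
        (Limits.Sigma.hom_ext _ _ fun j => Quiver.Hom.unop_inj ?_)⟩
      simp [hy]
    intro g hg
    obtain ⟨l, hl⟩ := ((hI i).exact_iff _ _).2 hprod g.unop (Quiver.Hom.op_inj hg)
    exact ⟨l.op, Quiver.Hom.unop_inj hl⟩
  surjective_of_injective {X Y Z} a b c hD h i g := by
    have hD' := unop_distinguished _ hD
    have hsurj : ∀ j (x : G j ⟶ X.unop), ∃ y, y ≫ a.unop = x := fun j x =>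
      ((hI j).exact_iff a.unop (0 : X.unop ⟶ X.unop)).1 (fun g hg =>
        ⟨0, by
          rw [Limits.comp_zero]
          exact Quiver.Hom.op_inj (h j g.op (Quiver.Hom.unop_inj hg)).symm⟩) x Limits.comp_zero
    have hinj : ∀ x : G i ⟶ Z.unop, x ≫ b.unop = 0 → x = 0 :=
      hG.injective_of_surjective b.unop a.unop _ hD' hsurj i
    obtain ⟨l, hl⟩ := ((hI i).exact_iff (0 : Z.unop ⟶ Z.unop) b.unop).2
      (fun x hx => ⟨0, by rw [hinj x hx, Limits.comp_zero]⟩) g.unop Limits.zero_comp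
    exact ⟨l.op, Quiver.Hom.unop_inj hl⟩

end BrownComenetz

section Adjoint

variable {C : Type u} [Category.{v} C] [Preadditive C] [HasZeroObject C] [HasShift C ℤ]
  [∀ n : ℤ, (shiftFunctor C n).Additive] [Pretriangulated C] [HasCoproducts.{v} C]
  {D : Type u₂} [Category.{v} D] [Preadditive D] [HasZeroObject D] [HasShift D ℤ]
  [∀ n : ℤ, (shiftFunctor D n).Additive] [Pretriangulated D]
  (F : C ⥤ D) [F.CommShift ℤ] [F.IsTriangulated]

/-- The functor `Hom(F -, s)`, for a coproduct-preserving triangulated functor `F`. -/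
def homFrom (hF : PreservesCoproducts F) (s : D) : CohomologicalFunctor C where
  obj X := F.obj X ⟶ s
  map f := AddMonoidHom.mk' (fun y => F.map f ≫ y) (fun _ _ => Preadditive.comp_add _ _ _ _ _ _)
  map_id x := by simp
  map_comp f g z := by simp
  map_add f g y := by simp
  exact a b c hD y hy := by
    obtain ⟨z, hz⟩ := Triangle.yoneda_exact₂ _ (F.map_distinguished _ hD) y hy
    exact ⟨z, hz.symm⟩
  sigma_ext {J} X x hx := by
    have := (hF J).some
    exact Cofan.IsColimit.hom_ext
      (isColimitCofanMkObjOfIsColimit F _ _ (coproductIsCoproduct X)) _ _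
      fun j => (hx j).trans Limits.comp_zero.symm
  sigma_lift {J} X x := by
    have := (hF J).some
    have hc := isColimitCofanMkObjOfIsColimit F _ _ (coproductIsCoproduct X)
    exact ⟨Cofan.IsColimit.desc hc x, Cofan.IsColimit.fac hc x⟩

lemma PerfectlyGenerates.isLeftAdjoint {ι : Type v} {G : ι → C} (hG : PerfectlyGenerates G)
    (hF : PreservesCoproducts F) : F.IsLeftAdjoint := by
  have h : ∀ s, ∃ (R : C) (r : F.obj R ⟶ s),
      ∀ Y, Function.Bijective fun f : Y ⟶ R => F.map f ≫ r :=
    fun s => hG.exists_representing (homFrom F hF s)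
  choose R r hr using h
  exact (Adjunction.adjunctionOfEquivRight
    (fun X s => (Equiv.ofBijective _ (hr s X)).symm) (fun X Y s f g => by
      rw [Equiv.symm_apply_eq]
      have hg : F.map ((Equiv.ofBijective _ (hr s Y)).symm g) ≫ r s = g :=
        (Equiv.ofBijective _ (hr s Y)).apply_symm_apply g
      change _ = F.map _ ≫ r s
      rw [F.map_comp, Category.assoc, hg])).isLeftAdjoint

end Adjoint

/-- Brown representability / Corollary 2.3. -/
theorem statement0 {T : Type u₁} {S : Type u₂}
    [Category.{v} T] [Preadditive T] [HasZeroObject T] [HasShift T ℤ]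
    [∀ n : ℤ, (shiftFunctor T n).Additive] [Pretriangulated T] [IsTriangulated T]
    [Category.{v} S] [Preadditive S] [HasZeroObject S] [HasShift S ℤ]
    [∀ n : ℤ, (shiftFunctor S n).Additive] [Pretriangulated S] [IsTriangulated S]
    (F : T ⥤ S) [F.CommShift ℤ] [F.IsTriangulated]
    (hT : CompactlyGenerated T) :
    (F.IsLeftAdjoint ↔ PreservesCoproducts F) ∧
    (F.IsRightAdjoint ↔ PreservesProducts F) := by
  have := hT.hasCoproducts
  obtain ⟨ι, G, hG⟩ := hT.exists_isCompactFamily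
  refine ⟨⟨fun _ J => ⟨inferInstance⟩, fun hF => hG.perfectlyGenerates.isLeftAdjoint F hF⟩,
    ⟨fun _ J => ⟨inferInstance⟩, fun hF => ?_⟩⟩
  have : HasProducts.{v} T := hG.perfectlyGenerates.hasProducts
  have : HasCoproducts.{v} Tᵒᵖ := fun J => inferInstance
  choose I χ hI using fun i =>
    hG.perfectlyGenerates.exists_representing (characterHom (hG.factorsFinitely i))
  have hFop : PreservesCoproducts F.op := fun J => by
    have := (hF J).some
    have : PreservesLimitsOfShape (Discrete J)ᵒᵖ F :=
      preservesLimitsOfShape_of_equiv (Discrete.opposite J).symm F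
    exact ⟨preservesColimitsOfShape_op _ F⟩
  have : F.op.IsLeftAdjoint :=
    (hG.perfectlyGenerates_op (I := I) (χ := χ) hI).isLeftAdjoint F.op hFop
  exact (Adjunction.ofIsLeftAdjoint F.op).unop.isRightAdjoint

end GN
end
end

section
/- Let f* : D → C be a coproduct-preserving tensor-exact functor between rigidly-compactly generated tensor-triangulated categories, with right adjoint f_*. If f* admits a left adjoint (equivalently, if f* preserves arbitrary products), then f_* preserves compact objects: f_*(C^c) ⊆ D^c. -/
/-!
Formalization of statements from "Grothendieck-Neeman duality and the
Wirthmüller isomorphism" by Balmer, Dell'Ambrogio and Sanders.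
-/

noncomputable section

open CategoryTheory CategoryTheory.Limits CategoryTheory.Pretriangulated
  CategoryTheory.MonoidalCategory CategoryTheory.MonoidalClosed Opposite

universe v u u₁ u₂ u₃

namespace GN

section Duals

variable {C : Type u₁} [Category.{v} C] [MonoidalCategory C]

/-- The exact pairing between `hom(x,𝟙)` and `x`, for a rigid object `x`. -/
@[reducible] def IsRigid.exactPairing [MonoidalClosed C] {x : C} (hx : IsRigid x) :
    ExactPairing ((ihom x).obj (𝟙_ C)) x :=
  haveI := hx x
  let e : x ⊗ (ihom x).obj (𝟙_ C) ⟶ 𝟙_ C := (ihom.ev x).app (𝟙_ C)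
  let c : 𝟙_ C ⟶ (ihom x).obj (𝟙_ C) ⊗ x :=
    MonoidalClosed.curry (ρ_ x).hom ≫ inv (rigidComparison x x)
  have hc : x ◁ c ≫ (α_ _ _ _).inv ≫ e ▷ x = (ρ_ x).hom ≫ (λ_ x).inv := by
    have h : c ≫ rigidComparison x x = MonoidalClosed.curry (ρ_ x).hom := by simp [c]
    rw [rigidComparison, ← MonoidalClosed.curry_natural_left] at h
    simp [e, ← MonoidalClosed.curry_injective h]
  { coevaluation' := c
    evaluation' := e
    coevaluation_evaluation' := hc
    evaluation_coevaluation' := by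
      rw [← cancel_mono (ρ_ _).hom]
      apply MonoidalClosed.uncurry_injective
      rw [MonoidalClosed.uncurry_eq, MonoidalClosed.uncurry_eq]
      change _ ≫ e = _ ≫ e
      have hc' : x ◁ c ⊗≫ e ▷ x = ⊗𝟙.hom := by
        convert! hc <;> simp [monoidalComp]
      calc
        _ = 𝟙 _ ⊗≫ (x ◁ c) ▷ (ihom x).obj (𝟙_ C) ⊗≫
            ((x ⊗ (ihom x).obj (𝟙_ C)) ◁ e ≫ e ▷ (𝟙_ C)) ⊗≫ 𝟙 _ := by
          monoidal
        _ = 𝟙 _ ⊗≫ (x ◁ c ⊗≫ e ▷ x) ▷ (ihom x).obj (𝟙_ C) ⊗≫ e := by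
          rw [whisker_exchange]; monoidal
        _ = _ := by
          rw [hc']; monoidal }

/-- An object which admits a left dual is rigid. -/
lemma isRigid_of_exactPairing [MonoidalClosed C] (y x : C) [ExactPairing y x] : IsRigid x := by
  intro z
  let e := (tensorLeftAdjunction y x).rightAdjointUniq (ihom.adjunction x)
  have he (t : C) : x ◁ e.hom.app t ≫ (ihom.ev x).app t =
      (α_ x y t).inv ≫ ExactPairing.evaluation y x ▷ t ≫ (λ_ t).hom := by
    have := Adjunction.rightAdjointUniq_hom_app_counit (tensorLeftAdjunction y x)
      (ihom.adjunction x) t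
    refine this.trans ?_
    simp [tensorLeftAdjunction, tensorLeftHomEquiv]
  have hz : ((ρ_ y).inv ≫ e.hom.app (𝟙_ C)) ▷ z ≫ rigidComparison x z = e.hom.app z := by
    apply MonoidalClosed.uncurry_injective
    rw [MonoidalClosed.uncurry_eq (e.hom.app z), he, MonoidalClosed.uncurry_natural_left,
      rigidComparison, MonoidalClosed.uncurry_curry]
    calc
      _ = (α_ x y z).inv ≫ ((x ◁ (ρ_ y).inv) ≫ x ◁ e.hom.app (𝟙_ C) ≫
          (ihom.ev x).app (𝟙_ C)) ▷ z ≫ (λ_ z).hom := by monoidal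
      _ = _ := by rw [he]; monoidal
  have : IsIso (((ρ_ y).inv ≫ e.hom.app (𝟙_ C)) ▷ z ≫ rigidComparison x z) := by
    rw [hz]; infer_instance
  exact IsIso.of_isIso_comp_left (((ρ_ y).inv ≫ e.hom.app (𝟙_ C)) ▷ z) _

/-- The image of an exact pairing under a monoidal functor. -/
@[reducible] def mapExactPairing {D : Type u₂} [Category.{v} D] [MonoidalCategory D]
    (F : C ⥤ D) [F.Monoidal] (x y : C) [ExactPairing x y] :
    ExactPairing (F.obj x) (F.obj y) where
  coevaluation' := Functor.LaxMonoidal.ε F ≫ F.map (ExactPairing.coevaluation x y) ≫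
    Functor.OplaxMonoidal.δ F x y
  evaluation' := Functor.LaxMonoidal.μ F y x ≫ F.map (ExactPairing.evaluation x y) ≫
    Functor.OplaxMonoidal.η F
  coevaluation_evaluation' := by
    have h := (F.obj y ◁ Functor.LaxMonoidal.ε F ≫ Functor.LaxMonoidal.μ F y (𝟙_ C)) ≫=
      congrArg F.map (ExactPairing.coevaluation_evaluation x y) =≫
      (Functor.OplaxMonoidal.δ F (𝟙_ C) y ≫ Functor.OplaxMonoidal.η F ▷ F.obj y)
    simpa only [Functor.map_comp, Functor.Monoidal.map_whiskerLeft, Functor.Monoidal.map_whiskerRight,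
      Functor.Monoidal.map_associator_inv, Functor.Monoidal.map_rightUnitor,
      Functor.Monoidal.map_leftUnitor_inv,
      Functor.Monoidal.μ_δ_assoc, Functor.Monoidal.μ_δ, Functor.Monoidal.δ_μ_assoc,
      Functor.Monoidal.whiskerLeft_ε_η_assoc, Functor.Monoidal.whiskerRight_ε_η,
      MonoidalCategory.whiskerLeft_comp, comp_whiskerRight, Category.assoc, Category.comp_id] using h
  evaluation_coevaluation' := by
    have h := (Functor.LaxMonoidal.ε F ▷ F.obj x ≫ Functor.LaxMonoidal.μ F (𝟙_ C) x) ≫=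
      congrArg F.map (ExactPairing.evaluation_coevaluation x y) =≫
      (Functor.OplaxMonoidal.δ F x (𝟙_ C) ≫ F.obj x ◁ Functor.OplaxMonoidal.η F)
    simpa only [Functor.map_comp, Functor.Monoidal.map_whiskerLeft, Functor.Monoidal.map_whiskerRight,
      Functor.Monoidal.map_associator, Functor.Monoidal.map_rightUnitor_inv,
      Functor.Monoidal.map_leftUnitor,
      Functor.Monoidal.μ_δ_assoc, Functor.Monoidal.μ_δ, Functor.Monoidal.δ_μ_assoc,
      Functor.Monoidal.whiskerRight_ε_η_assoc, Functor.Monoidal.whiskerLeft_ε_η,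
      MonoidalCategory.whiskerLeft_comp, comp_whiskerRight, Category.assoc, Category.comp_id] using h

/-- For exact pairings of `a` with `a'` and of `b` with `b'`, the morphisms `f : a ⟶ b` and
`f' : b' ⟶ a'` are mates if they are adjoint with respect to the evaluations. -/
def AreMates {a a' b b' : C} [ExactPairing a a'] [ExactPairing b b'] (f : a ⟶ b) (f' : b' ⟶ a') :
    Prop :=
  b' ◁ f ≫ ExactPairing.evaluation b b' = f' ▷ a ≫ ExactPairing.evaluation a a'

namespace AreMates

variable {a a' b b' c c' : C} [ExactPairing a a'] [ExactPairing b b'] [ExactPairing c c']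

lemma whiskerRight_evaluation (f : b' ⟶ a') :
    f ▷ a ≫ ExactPairing.evaluation a a' =
      (tensorRightHomEquiv b' a a' (𝟙_ C)).symm (f ≫ (λ_ a').inv) := by
  simp only [tensorRightHomEquiv, Equiv.coe_fn_symm_mk]
  monoidal

lemma whiskerLeft_evaluation (f : a ⟶ b) :
    b' ◁ f ≫ ExactPairing.evaluation b b' =
      (tensorLeftHomEquiv a b b' (𝟙_ C)).symm (f ≫ (ρ_ b).inv) := by
  simp only [tensorLeftHomEquiv, Equiv.coe_fn_symm_mk]
  monoidal

lemma existsUnique_right (f : a ⟶ b) : ∃! f' : b' ⟶ a', AreMates f f' := by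
  simp only [AreMates, whiskerRight_evaluation]
  refine ⟨tensorRightHomEquiv b' a a' (𝟙_ C)
    (b' ◁ f ≫ ExactPairing.evaluation b b') ≫ (λ_ a').hom, by simp, fun g hg ↦ ?_⟩
  simp [hg]

lemma existsUnique_left (f' : b' ⟶ a') : ∃! f : a ⟶ b, AreMates f f' := by
  simp only [AreMates, whiskerLeft_evaluation]
  refine ⟨tensorLeftHomEquiv a b b' (𝟙_ C)
    (f' ▷ a ≫ ExactPairing.evaluation a a') ≫ (ρ_ b).hom, by simp, fun g hg ↦ ?_⟩
  simp [← hg]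

lemma comp {f : a ⟶ b} {f' : b' ⟶ a'} {g : b ⟶ c} {g' : c' ⟶ b'} (hf : AreMates f f')
    (hg : AreMates g g') : AreMates (f ≫ g) (g' ≫ f') := by
  unfold AreMates at *
  rw [MonoidalCategory.whiskerLeft_comp, Category.assoc, hg, comp_whiskerRight, Category.assoc,
    ← hf, whisker_exchange_assoc]

lemma map {D : Type u₂} [Category.{v} D] [MonoidalCategory D] (F : C ⥤ D) [F.Monoidal]
    {f : a ⟶ b} {f' : b' ⟶ a'} (hf : AreMates f f') :
    letI := mapExactPairing F a a'
    letI := mapExactPairing F b b'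
    AreMates (F.map f) (F.map f') := by
  change F.obj b' ◁ F.map f ≫ Functor.LaxMonoidal.μ F b' b ≫
      F.map (ExactPairing.evaluation b b') ≫ Functor.OplaxMonoidal.η F =
    F.map f' ▷ F.obj a ≫ Functor.LaxMonoidal.μ F a' a ≫
      F.map (ExactPairing.evaluation a a') ≫ Functor.OplaxMonoidal.η F
  rw [Functor.LaxMonoidal.μ_natural_right_assoc, Functor.LaxMonoidal.μ_natural_left_assoc,
    ← F.map_comp_assoc, ← F.map_comp_assoc, hf]

end AreMates

end Duals

section Compactness

variable {C : Type u₁} [Category.{v} C] [Preadditive C]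

lemma IsCompactObj.of_iso {x y : C} (e : x ≅ y) (hx : IsCompactObj x) : IsCompactObj y := by
  intro J
  obtain ⟨_⟩ := hx J
  exact ⟨preservesColimitsOfShape_of_natIso (preadditiveCoyoneda.mapIso e.symm.op)⟩

/-- The left adjoint of an additive coproduct-preserving functor preserves compact objects. -/
lemma IsCompactObj.map_leftAdjoint {D : Type u₂} [Category.{v} D] [Preadditive D]
    {F : C ⥤ D} {G : D ⥤ C} (adj : F ⊣ G) [G.Additive] (hG : PreservesCoproducts G)
    {x : C} (hx : IsCompactObj x) : IsCompactObj (F.obj x) := by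
  intro J
  obtain ⟨_⟩ := hx J
  obtain ⟨_⟩ := hG J
  have := adj.left_adjoint_additive
  let e : G ⋙ preadditiveCoyoneda.obj (op x) ≅ preadditiveCoyoneda.obj (op (F.obj x)) :=
    NatIso.ofComponents (fun y ↦ (adj.homAddEquiv x y).symm.toAddCommGrpIso) (fun f ↦ by
      ext g
      exact adj.homEquiv_naturality_right_symm _ _)
  exact ⟨preservesColimitsOfShape_of_natIso e⟩

variable [HasShift C ℤ] [∀ n : ℤ, (shiftFunctor C n).Additive]

lemma IsCompactObj.shift {x : C} (hx : IsCompactObj x) (n : ℤ) : IsCompactObj (x⟦n⟧) :=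
  haveI : (shiftEquiv C n).inverse.Additive := inferInstanceAs (shiftFunctor C (-n)).Additive
  hx.map_leftAdjoint (shiftEquiv C n).toAdjunction (fun _ ↦ ⟨inferInstance⟩)

/-- In a compactly generated triangulated category, the morphisms which induce bijections on
morphisms from compact objects are isomorphisms. -/
lemma isIso_of_bijective_of_isCompactObj [HasZeroObject C] [Pretriangulated C]
    (hC : ∃ (ι : Type v) (G : ι → C), (∀ i, IsCompactObj (G i)) ∧
      ∀ t : C, (∀ (i : ι) (f : G i ⟶ t), f = 0) → IsZero t)
    {a b : C} (φ : a ⟶ b)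
    (hφ : ∀ z : C, IsCompactObj z → Function.Bijective (fun g : z ⟶ a ↦ g ≫ φ)) : IsIso φ := by
  obtain ⟨ι, G, hG, hG'⟩ := hC
  obtain ⟨c, p, q, hT⟩ := distinguished_cocone_triangle φ
  refine (Triangle.isZero₃_iff_isIso₁ _ hT).1 (hG' _ fun i (f : G i ⟶ c) ↦ ?_)
  have h₁₂ : φ ≫ p = 0 := comp_distTriang_mor_zero₁₂ _ hT
  have h₃₁ : q ≫ φ⟦(1 : ℤ)⟧' = 0 := comp_distTriang_mor_zero₃₁ _ hT
  have hq : f ≫ q = 0 := by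
    let e := shiftFunctorCompIsoId C (1 : ℤ) (-1) (by simp)
    have hφ₀ : ((f ≫ q)⟦(-1 : ℤ)⟧' ≫ e.hom.app a) ≫ φ = 0 := by
      have := e.hom.naturality φ
      dsimp at this
      rw [Category.assoc, ← this, ← Functor.map_comp_assoc, Category.assoc, h₃₁, comp_zero,
        Functor.map_zero, zero_comp]
    have h₀ : (f ≫ q)⟦(-1 : ℤ)⟧' ≫ e.hom.app a = 0 :=
      (hφ _ ((hG i).shift (-1))).1 (by simpa using hφ₀)
    apply (shiftFunctor C (-1 : ℤ)).map_injective
    rw [← cancel_mono (e.hom.app a), h₀, Functor.map_zero, zero_comp]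
  obtain ⟨g, rfl⟩ := Triangle.coyoneda_exact₃ _ hT f hq
  obtain ⟨k, rfl⟩ := (hφ _ (hG i)).2 g
  change (k ≫ φ) ≫ p = 0
  rw [Category.assoc, h₁₂, comp_zero]

end Compactness

/-- Lemma 3.2. -/
theorem statement4 {D : Type u₁} {C : Type u₂}
    [Category.{v} D] [Preadditive D] [HasZeroObject D] [HasShift D ℤ]
    [∀ n : ℤ, (shiftFunctor D n).Additive] [Pretriangulated D] [IsTriangulated D]
    [MonoidalCategory D] [SymmetricCategory D] [MonoidalClosed D]
    [Category.{v} C] [Preadditive C] [HasZeroObject C] [HasShift C ℤ]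
    [∀ n : ℤ, (shiftFunctor C n).Additive] [Pretriangulated C] [IsTriangulated C]
    [MonoidalCategory C] [SymmetricCategory C] [MonoidalClosed C]
    (fstar : D ⥤ C) [fstar.Braided] [fstar.CommShift ℤ] [fstar.IsTriangulated]
    (hD : RigidlyCompactlyGenerated D) (hC : RigidlyCompactlyGenerated C)
    (hcop : PreservesCoproducts fstar)
    (fpush : C ⥤ D) (adj1 : fstar ⊣ fpush)
    (h : fstar.IsRightAdjoint) :
    ∀ x : C, IsCompactObj x → IsCompactObj (fpush.obj x) := by
  intro x hx
  let adj0 := Adjunction.ofIsRightAdjoint fstar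
  have : ExactPairing ((ihom x).obj (𝟙_ C)) x := ((hC.compact_iff_rigid x).1 hx).exactPairing
  generalize (ihom x).obj (𝟙_ C) = x' at *
  have hx' : IsCompactObj x' := by
    rw [hC.compact_iff_rigid]
    have := BraidedCategory.exactPairing_swap x' x
    exact isRigid_of_exactPairing x x'
  let w := fstar.leftAdjoint.obj x'
  have hw : IsCompactObj w := hx'.map_leftAdjoint adj0 hcop
  have := ((hD.compact_iff_rigid w).1 hw).exactPairing
  have := BraidedCategory.exactPairing_swap ((ihom w).obj (𝟙_ D)) w
  generalize (ihom w).obj (𝟙_ D) = w' at *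
  have hw' : IsCompactObj w' := (hD.compact_iff_rigid w').2 (isRigid_of_exactPairing w w')
  let := mapExactPairing fstar w w'
  obtain ⟨u, hu, -⟩ := AreMates.existsUnique_right (b' := fstar.obj w') (a' := x)
    (adj0.homEquiv x' w (𝟙 w))
  have hbij (z : D) (hz : IsCompactObj z) :
      Function.Bijective (fun g : z ⟶ w' ↦ g ≫ adj1.homEquiv _ _ u) := by
    have := ((hD.compact_iff_rigid z).1 hz).exactPairing
    generalize (ihom z).obj (𝟙_ D) = z' at *
    let := mapExactPairing fstar z' z
    have mates {k : w ⟶ z'} {g : z ⟶ w'} (hk : AreMates k g) :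
        AreMates (adj0.homEquiv _ _ k) (fstar.map g ≫ u) := by
      have hcomp : adj0.homEquiv x' w (𝟙 w) ≫ fstar.map k = adj0.homEquiv _ _ k :=
        (adj0.homEquiv_naturality_right _ _).symm.trans (congrArg _ (Category.id_comp k))
      rw [← hcomp]
      exact hu.comp (hk.map fstar)
    have hbij' : Function.Bijective (fun g : z ⟶ w' ↦ fstar.map g ≫ u) := by
      refine ⟨fun g₁ g₂ hg ↦ ?_, fun l ↦ ?_⟩
      · obtain ⟨k₁, hk₁, -⟩ := AreMates.existsUnique_left (a := w) (b := z') g₁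
        obtain ⟨k₂, hk₂, -⟩ := AreMates.existsUnique_left (a := w) (b := z') g₂
        have hl := mates hk₁
        rw [show fstar.map g₁ ≫ u = fstar.map g₂ ≫ u from hg] at hl
        obtain rfl : k₁ = k₂ := (adj0.homEquiv _ _).injective
          ((AreMates.existsUnique_left _).unique hl (mates hk₂))
        exact (AreMates.existsUnique_right _).unique hk₁ hk₂
      · obtain ⟨k, hk, -⟩ := AreMates.existsUnique_left (a := x') (b := fstar.obj z') l
        obtain ⟨k, rfl⟩ := (adj0.homEquiv _ _).surjective k
        obtain ⟨g, hg, -⟩ := AreMates.existsUnique_right (a' := w') (b' := z) k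
        exact ⟨g, (AreMates.existsUnique_right _).unique (mates hg) hk⟩
    convert! (adj1.homEquiv _ _).bijective.comp hbij' using 2 with g
    exact (adj1.homEquiv_naturality_left g u).symm
  have := isIso_of_bijective_of_isCompactObj hD.exists_generators _ hbij
  exact hw'.of_iso (asIso (adj1.homEquiv _ _ u))

end GN
end
end

section
/- Let f* : D → C be a coproduct-preserving tensor-exact functor between rigidly-compactly generated tensor-triangulated categories, with adjoints f* ⊣ f_* ⊣ f^(1). If f_* preserves compact objects, then the canonical natural comparison map f^(1)(x) ⊗ f*(y) → f^(1)(x ⊗ y), obtained by adjunction from the counit f_* f^(1) → Id via the projection formula f_*(f^(1)(x) ⊗ f*(y)) ≅ f_* f^(1)(x) ⊗ y, is an isomorphism for all x, y ∈ D. -/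
/-!
Formalization of statements from "Grothendieck-Neeman duality and the
Wirthmüller isomorphism" by Balmer, Dell'Ambrogio and Sanders.
-/

noncomputable section

open CategoryTheory CategoryTheory.Limits CategoryTheory.Pretriangulated
  CategoryTheory.MonoidalCategory CategoryTheory.MonoidalClosed Opposite

universe v u u₁ u₂ u₃

namespace GN

section ShiftCompact

variable {C : Type u} [Category.{v} C] [Preadditive C] [HasShift C ℤ]
  [∀ n : ℤ, (shiftFunctor C n).Additive]

/-- Compact objects are stable under shifts. -/
lemma IsCompactObj.shift_s5 {t : C} (ht : IsCompactObj t) (n : ℤ) : IsCompactObj (t⟦n⟧) := by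
  intro J
  obtain ⟨_⟩ := ht J
  let adj : shiftFunctor C n ⊣ shiftFunctor C (-n) := (shiftEquiv C n).toAdjunction
  have : PreservesColimitsOfShape (Discrete J) (shiftFunctor C (-n)) := inferInstance
  let e : shiftFunctor C (-n) ⋙ preadditiveCoyoneda.obj (op t) ≅
      preadditiveCoyoneda.obj (op (t⟦n⟧)) :=
    NatIso.ofComponents
      (fun X => AddEquiv.toAddCommGrpIso (adj.homAddEquiv t X).symm)
      (fun f => by
        ext g
        exact adj.homEquiv_naturality_right_symm g f)
  exact ⟨preservesColimitsOfShape_of_natIso e⟩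

variable [HasZeroObject C] [Pretriangulated C]

/-- In a triangulated category with a set of compact generators, a morphism inducing bijections
on maps out of compact objects is an isomorphism. -/
lemma isIso_of_bijective_comp_of_isCompactObj {ι : Type v} (G : ι → C)
    (hG : ∀ i, IsCompactObj (G i))
    (hG₀ : ∀ t : C, (∀ (i : ι) (f : G i ⟶ t), f = 0) → IsZero t)
    {X Y : C} (φ : X ⟶ Y)
    (hφ : ∀ c : C, IsCompactObj c → Function.Bijective (fun g : c ⟶ X => g ≫ φ)) :
    IsIso φ := by
  obtain ⟨Z, p, q, hT⟩ := distinguished_cocone_triangle φ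
  refine (Triangle.isZero₃_iff_isIso₁ _ hT).1 (hG₀ Z fun i g => ?_)
  have hinj : ∀ k : G i ⟶ X⟦(1 : ℤ)⟧, k ≫ φ⟦(1 : ℤ)⟧' = 0 → k = 0 := by
    intro k hk
    let adj : shiftFunctor C (-1 : ℤ) ⊣ shiftFunctor C (1 : ℤ) :=
      (shiftEquiv C (1 : ℤ)).symm.toAdjunction
    apply (adj.homAddEquiv _ _).symm.injective
    rw [map_zero]
    apply (hφ _ ((hG i).shift_s5 (-1))).1
    change (adj.homEquiv _ _).symm k ≫ φ = 0 ≫ φ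
    rw [← adj.homEquiv_naturality_right_symm, hk, zero_comp]
    exact map_zero (adj.homAddEquiv _ _).symm
  have hq : g ≫ q = 0 := hinj _ (by
    rw [Category.assoc, show q ≫ φ⟦(1 : ℤ)⟧' = 0 from comp_distTriang_mor_zero₃₁ _ hT, comp_zero])
  obtain ⟨k, rfl⟩ := Triangle.coyoneda_exact₃ _ hT g hq
  obtain ⟨l, rfl⟩ := (hφ _ (hG i)).2 k
  change (l ≫ φ) ≫ p = 0
  rw [Category.assoc, show φ ≫ p = 0 from comp_distTriang_mor_zero₁₂ _ hT, comp_zero]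

end ShiftCompact

section TensorHom

variable {C : Type u} [Category.{v} C] [MonoidalCategory C] [MonoidalClosed C]

/-- The canonical map `hom(c,x) ⊗ y ⟶ hom(c,x ⊗ y)`. -/
def tensorHomComparison (c x y : C) : (ihom c).obj x ⊗ y ⟶ (ihom c).obj (x ⊗ y) :=
  MonoidalClosed.curry ((α_ c ((ihom c).obj x) y).inv ≫ ((ihom.ev c).app x ▷ y))

lemma whiskerLeft_tensorHomComparison_ev (c x y : C) :
    c ◁ tensorHomComparison c x y ≫ (ihom.ev c).app (x ⊗ y) =
      (α_ c ((ihom c).obj x) y).inv ≫ ((ihom.ev c).app x ▷ y) := by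
  rw [← MonoidalClosed.uncurry_eq, tensorHomComparison, MonoidalClosed.uncurry_curry]

lemma whiskerLeft_rigidComparison_ev (c x : C) :
    c ◁ rigidComparison c x ≫ (ihom.ev c).app x =
      (α_ c ((ihom c).obj (𝟙_ C)) x).inv ≫ ((ihom.ev c).app (𝟙_ C) ▷ x) ≫ (λ_ x).hom := by
  rw [← MonoidalClosed.uncurry_eq, rigidComparison, MonoidalClosed.uncurry_curry]

lemma rigidComparison_tensor (c x y : C) :
    rigidComparison c x ▷ y ≫ tensorHomComparison c x y =
      (α_ ((ihom c).obj (𝟙_ C)) x y).hom ≫ rigidComparison c (x ⊗ y) := by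
  apply MonoidalClosed.uncurry_injective
  rw [MonoidalClosed.uncurry_eq, MonoidalClosed.uncurry_eq]
  simp only [MonoidalCategory.whiskerLeft_comp, Category.assoc,
    whiskerLeft_tensorHomComparison_ev, whiskerLeft_rigidComparison_ev]
  rw [associator_inv_naturality_middle_assoc, ← comp_whiskerRight,
    whiskerLeft_rigidComparison_ev]
  monoidal

lemma IsRigid.isIso_tensorHomComparison {c : C} (hc : IsRigid c) (x y : C) :
    IsIso (tensorHomComparison c x y) := by
  have := hc x
  have := hc (x ⊗ y)
  have : IsIso (rigidComparison c x ▷ y ≫ tensorHomComparison c x y) := by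
    rw [rigidComparison_tensor]
    infer_instance
  exact IsIso.of_isIso_comp_left (rigidComparison c x ▷ y) _

end TensorHom

section RightProjection

variable {D : Type u₁} {C : Type u₂} [Category.{v} D] [Category.{v} C]
  [MonoidalCategory D] [MonoidalCategory C]
  (fstar : D ⥤ C) (fpush : C ⥤ D) (adj1 : fstar ⊣ fpush)

section

variable [fstar.Monoidal]

/-- The projection formula map with the tensor factors exchanged:
`f_*(b) ⊗ y ⟶ f_*(b ⊗ f^*(y))`. -/
def rightProjFormula (b : C) (y : D) : fpush.obj b ⊗ y ⟶ fpush.obj (b ⊗ fstar.obj y) :=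
  (adj1.homEquiv _ _)
    (Functor.OplaxMonoidal.δ fstar (fpush.obj b) y ≫ (adj1.counit.app b ▷ fstar.obj y))

lemma map_rightProjFormula_counit (b : C) (y : D) :
    fstar.map (rightProjFormula fstar fpush adj1 b y) ≫ adj1.counit.app _ =
      Functor.OplaxMonoidal.δ fstar (fpush.obj b) y ≫ (adj1.counit.app b ▷ fstar.obj y) := by
  refine (adj1.homEquiv_counit ..).symm.trans ?_
  exact Equiv.symm_apply_apply _ _

lemma rightProjFormula_naturality_left {b b' : C} (g : b ⟶ b') (y : D) :
    fpush.map g ▷ y ≫ rightProjFormula fstar fpush adj1 b' y =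
      rightProjFormula fstar fpush adj1 b y ≫ fpush.map (g ▷ fstar.obj y) := by
  apply (adj1.homEquiv _ _).symm.injective
  simp only [adj1.homEquiv_counit, Functor.map_comp, Category.assoc, map_rightProjFormula_counit,
    adj1.counit_naturality, reassoc_of% (map_rightProjFormula_counit fstar fpush adj1 b y)]
  rw [← Functor.OplaxMonoidal.δ_natural_left_assoc, ← comp_whiskerRight]
  dsimp only [Functor.id_obj]
  rw [adj1.counit_naturality, comp_whiskerRight]

lemma rightProjFormula_naturality_right (b : C) {y y' : D} (g : y ⟶ y') :
    fpush.obj b ◁ g ≫ rightProjFormula fstar fpush adj1 b y' =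
      rightProjFormula fstar fpush adj1 b y ≫ fpush.map (b ◁ fstar.map g) := by
  apply (adj1.homEquiv _ _).symm.injective
  simp only [adj1.homEquiv_counit, Functor.map_comp, Category.assoc, map_rightProjFormula_counit,
    adj1.counit_naturality, reassoc_of% (map_rightProjFormula_counit fstar fpush adj1 b y)]
  rw [← Functor.OplaxMonoidal.δ_natural_right_assoc, whisker_exchange]
  rfl

/-- Associativity of the projection formula map. -/
lemma rightProjFormula_assoc (c b : C) (y : D) :
    (α_ (fpush.obj c) (fpush.obj b) y).inv ≫
      (rightProjFormula fstar fpush adj1 c (fpush.obj b) ≫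
        fpush.map (c ◁ adj1.counit.app b)) ▷ y ≫
      rightProjFormula fstar fpush adj1 (c ⊗ b) y =
    fpush.obj c ◁ rightProjFormula fstar fpush adj1 b y ≫
      rightProjFormula fstar fpush adj1 c (fpush.obj (b ⊗ fstar.obj y)) ≫
      fpush.map (c ◁ adj1.counit.app _ ≫ (α_ c b (fstar.obj y)).inv) := by
  apply (adj1.homEquiv _ _).symm.injective
  simp only [adj1.homEquiv_counit, Functor.map_comp, Category.assoc, map_rightProjFormula_counit,
    adj1.counit_naturality, adj1.counit_naturality_assoc,
    reassoc_of% (map_rightProjFormula_counit fstar fpush adj1)]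
  dsimp only [Functor.id_obj]
  rw [← Functor.OplaxMonoidal.δ_natural_left_assoc, ← Functor.OplaxMonoidal.δ_natural_right_assoc,
    ← comp_whiskerRight, whisker_exchange_assoc, ← MonoidalCategory.whiskerLeft_comp_assoc,
    map_rightProjFormula_counit]
  simp only [Functor.map_comp, Category.assoc, adj1.counit_naturality,
    reassoc_of% (map_rightProjFormula_counit fstar fpush adj1), comp_whiskerRight]
  rw [MonoidalCategory.whiskerLeft_comp_assoc, ← whisker_exchange_assoc,
    ← reassoc_of% (Functor.OplaxMonoidal.associativity_inv fstar)]
  dsimp only [Functor.id_obj]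
  simp

/-- The canonical map `f_* hom(c, f^(1)(x)) ⟶ hom(f_*(c), x)`. -/
def pushHomComparison [MonoidalClosed C] [MonoidalClosed D] (fone : D ⥤ C) (adj2 : fpush ⊣ fone)
    (c : C) (x : D) :
    fpush.obj ((ihom c).obj (fone.obj x)) ⟶ (ihom (fpush.obj c)).obj x :=
  MonoidalClosed.curry (
    rightProjFormula fstar fpush adj1 c (fpush.obj ((ihom c).obj (fone.obj x))) ≫
    fpush.map (c ◁ adj1.counit.app ((ihom c).obj (fone.obj x)) ≫
      (ihom.ev c).app (fone.obj x)) ≫ adj2.counit.app x)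

variable {fstar fpush adj1}

lemma whiskerLeft_pushHomComparison_ev [MonoidalClosed C] [MonoidalClosed D]
    (fone : D ⥤ C) (adj2 : fpush ⊣ fone) (c : C) (x : D) :
    fpush.obj c ◁ pushHomComparison fstar fpush adj1 fone adj2 c x ≫ (ihom.ev _).app x =
      rightProjFormula fstar fpush adj1 c (fpush.obj ((ihom c).obj (fone.obj x))) ≫
        fpush.map (c ◁ adj1.counit.app ((ihom c).obj (fone.obj x)) ≫
          (ihom.ev c).app (fone.obj x)) ≫ adj2.counit.app x := by
  rw [← MonoidalClosed.uncurry_eq, pushHomComparison, MonoidalClosed.uncurry_curry]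

lemma isIso_pushHomComparison [MonoidalClosed C] [MonoidalClosed D]
    (fone : D ⥤ C) (adj2 : fpush ⊣ fone)
    (hπ : ∀ (b : C) (y : D), IsIso (rightProjFormula fstar fpush adj1 b y)) (c : C) (x : D) :
    IsIso (pushHomComparison fstar fpush adj1 fone adj2 c x) := by
  rw [isIso_iff_yoneda_map_bijective]
  intro z
  have := hπ c z
  let e : (z ⟶ fpush.obj ((ihom c).obj (fone.obj x))) ≃ (z ⟶ (ihom (fpush.obj c)).obj x) :=
    (adj1.homEquiv _ _).symm.trans <| ((ihom.adjunction c).homEquiv _ _).symm.trans <|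
      (adj2.homEquiv _ _).symm.trans <|
      ((asIso (rightProjFormula fstar fpush adj1 c z)).symm.homCongr (Iso.refl x)).trans
        ((ihom.adjunction (fpush.obj c)).homEquiv _ _)
  convert e.bijective using 1
  ext g
  apply MonoidalClosed.uncurry_injective
  rw [MonoidalClosed.uncurry_natural_left, MonoidalClosed.uncurry_eq,
    whiskerLeft_pushHomComparison_ev,
    reassoc_of% (rightProjFormula_naturality_right fstar fpush adj1)]
  dsimp [e]
  rw [MonoidalClosed.homEquiv_apply_eq, MonoidalClosed.uncurry_curry,
    MonoidalClosed.homEquiv_symm_apply_eq, adj1.homEquiv_counit, adj2.homEquiv_counit,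
    MonoidalClosed.uncurry_eq]
  simp

end

section

variable {fstar fpush adj1} [SymmetricCategory D] [BraidedCategory C] [fstar.Braided]

lemma rightProjFormula_eq (b : C) (y : D) :
    rightProjFormula fstar fpush adj1 b y =
      (β_ (fpush.obj b) y).hom ≫ projFormula fstar fpush adj1 y b ≫
        fpush.map (β_ b (fstar.obj y)).inv := by
  apply (adj1.homEquiv _ _).symm.injective
  rw [adj1.homEquiv_naturality_left_symm, adj1.homEquiv_naturality_right_symm]
  simp only [rightProjFormula, projFormula, Equiv.symm_apply_apply, Functor.map_braiding,
    Category.assoc, Functor.Monoidal.μ_δ_assoc]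
  simp

lemma isIso_rightProjFormula (b : C) (y : D) [IsIso (projFormula fstar fpush adj1 y b)] :
    IsIso (rightProjFormula fstar fpush adj1 b y) := by
  rw [rightProjFormula_eq]
  infer_instance

lemma rightProjFormula_gnComparison
    (hπ : ∀ (x : D) (y : C), IsIso (projFormula fstar fpush adj1 x y))
    (fone : D ⥤ C) (adj2 : fpush ⊣ fone) (x y : D) :
    rightProjFormula fstar fpush adj1 (fone.obj x) y ≫
      fpush.map (gnComparison fstar fpush adj1 fone adj2 hπ x y) ≫ adj2.counit.app (x ⊗ y) =
    adj2.counit.app x ▷ y := by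
  have := hπ y (fone.obj x)
  have h := adj2.homEquiv_counit (g := gnComparison fstar fpush adj1 fone adj2 hπ x y)
  rw [gnComparison, Equiv.symm_apply_apply] at h
  dsimp only [Functor.id_obj] at h
  rw [gnComparison, ← h, rightProjFormula_eq]
  simp [← fpush.map_comp_assoc]

end

end RightProjection

section HomDetection

variable {D : Type u₁} {C : Type u₂} [Category.{v} D] [Category.{v} C]
  [MonoidalCategory D] [MonoidalCategory C] [MonoidalClosed C]
  {fstar : D ⥤ C} [fstar.Monoidal] {fpush : C ⥤ D}

/-- Maps out of `c` are the global sections of `f_* hom(c, -)`, so a morphism which becomes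
invertible after applying `f_* hom(c, -)` induces a bijection on maps out of `c`. -/
lemma bijective_comp_of_isIso_map_ihom_map (adj1 : fstar ⊣ fpush) (c : C) {X Y : C}
    (φ : X ⟶ Y) [IsIso (fpush.map ((ihom c).map φ))] :
    Function.Bijective (fun g : c ⟶ X => g ≫ φ) := by
  let e (Z : C) : (c ⟶ Z) ≃ (𝟙_ D ⟶ fpush.obj ((ihom c).obj Z)) :=
    ((ρ_ c).symm ≪≫ whiskerLeftIso c (Functor.Monoidal.εIso fstar)).homFromEquiv.trans <|
      ((ihom.adjunction c).homEquiv _ _).trans (adj1.homEquiv _ _)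
  have he : (fun g : c ⟶ X => g ≫ φ) =
      (e Y).symm ∘ (fun g => g ≫ fpush.map ((ihom c).map φ)) ∘ e X := by
    ext g
    apply (e Y).injective
    simp [e, ← Adjunction.homEquiv_naturality_right,
      ← (ihom.adjunction c).homEquiv_naturality_right]
  rw [he]
  exact (e Y).symm.bijective.comp
    (((asIso (fpush.map ((ihom c).map φ))).homToEquiv).bijective.comp (e X).bijective)

end HomDetection

section Duality

variable {D : Type u₁} {C : Type u₂} [Category.{v} D] [Category.{v} C]
  [MonoidalCategory D] [MonoidalCategory C] [MonoidalClosed C] [MonoidalClosed D]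
  [SymmetricCategory D] [BraidedCategory C]
  {fstar : D ⥤ C} [fstar.Braided] {fpush : C ⥤ D} {adj1 : fstar ⊣ fpush}
  {fone : D ⥤ C} {adj2 : fpush ⊣ fone}
  (hπ : ∀ (x : D) (y : C), IsIso (projFormula fstar fpush adj1 x y))

/-- Compatibility of the comparison map with `f_* hom(c, f^(1)(x)) ⟶ hom(f_*(c), x)`. -/
lemma pushHomComparison_tensor (c : C) (x y : D) :
    rightProjFormula fstar fpush adj1 ((ihom c).obj (fone.obj x)) y ≫
      fpush.map (tensorHomComparison c (fone.obj x) (fstar.obj y)) ≫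
      fpush.map ((ihom c).map (gnComparison fstar fpush adj1 fone adj2 hπ x y)) ≫
      pushHomComparison fstar fpush adj1 fone adj2 c (x ⊗ y) =
    pushHomComparison fstar fpush adj1 fone adj2 c x ▷ y ≫
      tensorHomComparison (fpush.obj c) x y := by
  apply MonoidalClosed.uncurry_injective
  rw [MonoidalClosed.uncurry_eq, MonoidalClosed.uncurry_eq]
  simp only [MonoidalCategory.whiskerLeft_comp, Category.assoc,
    whiskerLeft_tensorHomComparison_ev, whiskerLeft_pushHomComparison_ev]
  rw [associator_inv_naturality_middle_assoc, ← comp_whiskerRight,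
    whiskerLeft_pushHomComparison_ev]
  simp only [comp_whiskerRight, Functor.map_comp, Category.assoc]
  dsimp only [Functor.id_obj, Functor.comp_obj]
  rw [← rightProjFormula_gnComparison hπ fone adj2 x y,
    reassoc_of% (rightProjFormula_naturality_left fstar fpush adj1)]
  have h := rightProjFormula_assoc fstar fpush adj1 c ((ihom c).obj (fone.obj x)) y
  simp only [comp_whiskerRight, Functor.map_comp, Category.assoc] at h
  rw [reassoc_of% h, reassoc_of% (rightProjFormula_naturality_right fstar fpush adj1),
    reassoc_of% (rightProjFormula_naturality_right fstar fpush adj1)]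
  congr 2
  simp only [← Functor.map_comp_assoc]
  congr 2
  rw [← reassoc_of% (whiskerLeft_tensorHomComparison_ev c (fone.obj x) (fstar.obj y))]
  rw [← ihom.ev_naturality]
  simp only [← MonoidalCategory.whiskerLeft_comp_assoc,
    adj1.counit_naturality, adj1.counit_naturality_assoc]

/-- If `c` and `f_*(c)` are rigid then the comparison map becomes invertible
after applying `f_* hom(c, -)`. -/
lemma isIso_map_ihom_map_gnComparison {c : C} (hc : IsRigid c) (hc' : IsRigid (fpush.obj c))
    (x y : D) :
    IsIso (fpush.map ((ihom c).map (gnComparison fstar fpush adj1 fone adj2 hπ x y))) := by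
  have hr : ∀ (b : C) (y : D), IsIso (rightProjFormula fstar fpush adj1 b y) := fun b y =>
    have := hπ y b
    isIso_rightProjFormula b y
  have := hr ((ihom c).obj (fone.obj x)) y
  have := hc.isIso_tensorHomComparison (fone.obj x) (fstar.obj y)
  have := hc'.isIso_tensorHomComparison x y
  have := isIso_pushHomComparison fone adj2 hr c x
  have := isIso_pushHomComparison fone adj2 hr c (x ⊗ y)
  have h := pushHomComparison_tensor (adj2 := adj2) hπ c x y
  have : IsIso (rightProjFormula fstar fpush adj1 ((ihom c).obj (fone.obj x)) y ≫
      fpush.map (tensorHomComparison c (fone.obj x) (fstar.obj y)) ≫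
      fpush.map ((ihom c).map (gnComparison fstar fpush adj1 fone adj2 hπ x y)) ≫
      pushHomComparison fstar fpush adj1 fone adj2 c (x ⊗ y)) := by
    rw [h]
    infer_instance
  simpa only [isIso_comp_left_iff, isIso_comp_right_iff] using this

end Duality

/-- Proposition 3.3. -/
theorem statement5 {D : Type u₁} {C : Type u₂}
    [Category.{v} D] [Preadditive D] [HasZeroObject D] [HasShift D ℤ]
    [∀ n : ℤ, (shiftFunctor D n).Additive] [Pretriangulated D] [IsTriangulated D]
    [MonoidalCategory D] [SymmetricCategory D] [MonoidalClosed D]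
    [Category.{v} C] [Preadditive C] [HasZeroObject C] [HasShift C ℤ]
    [∀ n : ℤ, (shiftFunctor C n).Additive] [Pretriangulated C] [IsTriangulated C]
    [MonoidalCategory C] [SymmetricCategory C] [MonoidalClosed C]
    (fstar : D ⥤ C) [fstar.Braided] [fstar.CommShift ℤ] [fstar.IsTriangulated]
    (hD : RigidlyCompactlyGenerated D) (hC : RigidlyCompactlyGenerated C)
    (hcop : PreservesCoproducts fstar)
    (fpush : C ⥤ D) (adj1 : fstar ⊣ fpush)
    (fone : D ⥤ C) (adj2 : fpush ⊣ fone)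
    (hπ : ∀ (x : D) (y : C), IsIso (projFormula fstar fpush adj1 x y))
    (hcpt : ∀ x : C, IsCompactObj x → IsCompactObj (fpush.obj x)) :
    ∀ x y : D, IsIso (gnComparison fstar fpush adj1 fone adj2 hπ x y) := by
  intro x y
  obtain ⟨ι, G, hG, hG₀⟩ := hC.exists_generators
  refine isIso_of_bijective_comp_of_isCompactObj G hG hG₀ _ fun c hc => ?_
  have := isIso_map_ihom_map_gnComparison (adj2 := adj2) hπ ((hC.compact_iff_rigid c).1 hc)
    ((hD.compact_iff_rigid _).1 (hcpt c hc)) x y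
  exact bijective_comp_of_isIso_map_ihom_map adj1 c _

end GN
end
end
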